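/- Let p(n) denote the number of positroids on [n]. Then for every n ≥ 1, p(n) = Σ_{k=0}^{n} n!/k!, and consequently lim_{n→∞} p(n)/n! = e. -/

import Mathlib

open Finset

/-- A full-row-rank real `d × n` matrix is *totally nonnegative* if all of its
maximal (`d × d`) minors are nonnegative.  Columns are indexed by a finite
linearly ordered set `E`; a maximal minor is indexed by a strictly increasing
choice of `d` columns. -/
def Matrix.TotallyNonneg {d : ℕ} {E : Type*} [Fintype E] [LinearOrder E]
    (A : Matrix (Fin d) E ℝ) : Prop :=
  A.rank = d ∧ ∀ f : Fin d → E, StrictMono f → 0 ≤ (A.submatrix id f).det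

/-- `ℬ` is the collection of bases of the column matroid `M(A)`: the `d`-element
sets of column indices whose columns are linearly independent. -/
def Matrix.RepresentsBases {d : ℕ} {E : Type*} [Fintype E]
    (A : Matrix (Fin d) E ℝ) (ℬ : Finset E → Prop) : Prop :=
  ∀ B : Finset E, ℬ B ↔ B.card = d ∧ LinearIndependent ℝ (fun j : B => fun i => A i j.1)

/-- A positroid of rank `d` on the finite linearly ordered ground set `E`,
given by its collection of bases `ℬ`. -/
def IsPositroidOfRank (d : ℕ) {E : Type*} [Fintype E] [LinearOrder E]
    (ℬ : Finset E → Prop) : Prop :=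
  ∃ A : Matrix (Fin d) E ℝ, A.TotallyNonneg ∧ A.RepresentsBases ℬ

/-- A positroid on the finite linearly ordered ground set `E`. -/
def IsPositroid {E : Type*} [Fintype E] [LinearOrder E] (ℬ : Finset E → Prop) : Prop :=
  ∃ d, IsPositroidOfRank d ℬ


/-- The number of positroids on `[n]`, each positroid identified with its
(finite) collection of bases. -/
noncomputable def numPositroids (n : ℕ) : ℕ :=
  Nat.card {ℬ : Finset (Finset (Fin n)) // IsPositroid (fun B => B ∈ ℬ)}

namespace Positroid

lemma finrank_indep {n d : ℕ} (v : Fin n → Fin d → ℝ) (T : Finset (Fin n))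
    (h : LinearIndepOn ℝ v (T : Set (Fin n))) :
    Module.finrank ℝ (Submodule.span ℝ (v '' (T : Set (Fin n)))) = T.card := by
  have := finrank_span_eq_card (R := ℝ) h
  rw [Set.image_eq_range]
  simpa using this

lemma finrank_le {n d : ℕ} (v : Fin n → Fin d → ℝ) (T : Finset (Fin n)) :
    Module.finrank ℝ (Submodule.span ℝ (v '' (T : Set (Fin n)))) ≤ T.card := by
  classical
  have := finrank_span_finset_le_card (R := ℝ) (T.image v)
  rw [Finset.coe_image] at this
  exact this.trans Finset.card_image_le

lemma indep_of_span {n d : ℕ} (v : Fin n → Fin d → ℝ) (T : Finset (Fin n)) (hc : T.card = d)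
    (h : Submodule.span ℝ (v '' (T : Set (Fin n))) = ⊤) :
    LinearIndepOn ℝ v (T : Set (Fin n)) := by
  apply linearIndependent_of_top_le_span_of_card_eq_finrank
  · rw [← h, Set.image_eq_range]
  · simp [hc]

lemma span_of_indep {n d : ℕ} (v : Fin n → Fin d → ℝ) (T : Finset (Fin n)) (hc : T.card = d)
    (h : LinearIndepOn ℝ v (T : Set (Fin n))) :
    Submodule.span ℝ (v '' (T : Set (Fin n))) = ⊤ := by
  apply Submodule.eq_top_of_finrank_eq
  rw [finrank_indep v T h, hc]; simp

/-- Extend an independent set inside `J` to a spanning independent subset of `J`. -/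
lemma extend {n d : ℕ} (v : Fin n → Fin d → ℝ) (S J : Finset (Fin n)) (hSJ : S ⊆ J)
    (h : LinearIndepOn ℝ v (S : Set (Fin n))) :
    ∃ T : Finset (Fin n), S ⊆ T ∧ T ⊆ J ∧ LinearIndepOn ℝ v (T : Set (Fin n)) ∧
      Submodule.span ℝ (v '' (J : Set (Fin n))) = Submodule.span ℝ (v '' (T : Set (Fin n))) := by
  classical
  obtain ⟨b, hb, hsb, hsp, hli⟩ := exists_linearIndepOn_extension h (t := (J : Set (Fin n)))
    (by exact_mod_cast hSJ)
  refine ⟨b.toFinite.toFinset, ?_, ?_, ?_, ?_⟩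
  · intro x hx; simpa using hsb (by simpa using hx)
  · intro x hx; have := hb (by simpa using hx); simpa using this
  · simpa using hli
  · simp only [Set.Finite.coe_toFinset]
    apply le_antisymm
    · exact Submodule.span_le.2 hsp
    · exact Submodule.span_mono (Set.image_mono hb)

/-- Vandermonde sign of a choice of columns. -/
noncomputable def V {n d : ℕ} (g : Fin d → Fin n) : ℝ :=
  (Matrix.vandermonde (fun i => ((g i : ℕ) : ℝ))).det

/-- Determinant of a choice of columns. -/
noncomputable def Dt {n d : ℕ} (v : Fin n → Fin d → ℝ) (g : Fin d → Fin n) : ℝ :=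
  (Matrix.of (fun i => v (g i))).det

lemma V_perm {n d : ℕ} (g : Fin d → Fin n) (τ : Equiv.Perm (Fin d)) :
    V (g ∘ τ) = (Equiv.Perm.sign τ : ℤ) * V g := by
  unfold V
  rw [← Matrix.det_permute]
  rfl

lemma Dt_perm {n d : ℕ} (v : Fin n → Fin d → ℝ) (g : Fin d → Fin n) (τ : Equiv.Perm (Fin d)) :
    Dt v (g ∘ τ) = (Equiv.Perm.sign τ : ℤ) * Dt v g := by
  unfold Dt
  rw [← Matrix.det_permute]
  rfl

lemma VDt_perm {n d : ℕ} (v : Fin n → Fin d → ℝ) (g : Fin d → Fin n) (τ : Equiv.Perm (Fin d)) :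
    V (g ∘ τ) * Dt v (g ∘ τ) = V g * Dt v g := by
  rw [V_perm, Dt_perm]
  rcases Int.units_eq_one_or (Equiv.Perm.sign τ) with h | h <;> simp [h]

lemma V_ne_zero {n d : ℕ} (g : Fin d → Fin n) : V g ≠ 0 ↔ Function.Injective g := by
  unfold V
  rw [Matrix.det_vandermonde_ne_zero_iff]
  constructor
  · intro h a b hab; apply h; simp [hab]
  · intro h a b hab; apply h; apply Fin.ext; simpa using hab

lemma V_pos {n d : ℕ} (g : Fin d → Fin n) (hg : StrictMono g) : 0 < V g := by
  unfold V
  rw [Matrix.det_vandermonde]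
  refine Finset.prod_pos fun i _ => Finset.prod_pos fun j hj => ?_
  have : (g i : ℕ) < (g j : ℕ) := hg (by simpa using hj)
  have : ((g i : ℕ) : ℝ) < ((g j : ℕ) : ℝ) := by exact_mod_cast this
  linarith

lemma V_cons {n d : ℕ} (p : Fin n) (s : Fin d → Fin n) :
    V (Fin.cons p s : Fin (d + 1) → Fin n) = (∏ t, (((s t : ℕ) : ℝ) - ((p : ℕ) : ℝ))) * V s := by
  unfold V
  rw [Matrix.det_vandermonde, Matrix.det_vandermonde, Fin.prod_univ_succ, Fin.prod_Ioi_zero]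
  congr 1
  refine Finset.prod_congr rfl fun i _ => ?_
  rw [Fin.prod_Ioi_succ]
  simp

/-- cyclic-sign nonnegativity -/
def NN {n d : ℕ} (v : Fin n → Fin d → ℝ) : Prop := ∀ g : Fin d → Fin n, 0 ≤ V g * Dt v g

/-- Spanning. -/
def Sp {n d : ℕ} (v : Fin n → Fin d → ℝ) : Prop := Submodule.span ℝ (Set.range v) = ⊤

lemma Dt_eq {n d : ℕ} (A : Matrix (Fin d) (Fin n) ℝ) (g : Fin d → Fin n) :
    (A.submatrix id g).det = Dt A.col g := by
  unfold Dt
  rw [← Matrix.det_transpose]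
  rfl

lemma tnn_iff {n d : ℕ} (A : Matrix (Fin d) (Fin n) ℝ) :
    A.TotallyNonneg ↔ Sp A.col ∧ NN A.col := by
  unfold Matrix.TotallyNonneg
  have h1 : A.rank = d ↔ Sp A.col := by
    rw [Matrix.rank_eq_finrank_span_cols]
    unfold Sp
    constructor
    · intro h
      apply Submodule.eq_top_of_finrank_eq
      simpa using h
    · intro h
      change Module.finrank ℝ (Submodule.span ℝ (Set.range A.col)) = d
      rw [h]; simp
  rw [h1]
  refine and_congr_right fun _ => ⟨fun h g => ?_, fun h f hf => ?_⟩
  · by_cases hg : Function.Injective g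
    · rw [← VDt_perm _ g (Tuple.sort g)]
      have hm : StrictMono (g ∘ Tuple.sort g) :=
        (Tuple.monotone_sort g).strictMono_of_injective (hg.comp (Equiv.injective _))
      have := h _ hm
      rw [Dt_eq] at this
      exact mul_nonneg (V_pos _ hm).le this
    · have : V g = 0 := by
        by_contra h0; exact hg ((V_ne_zero g).1 h0)
      simp [this]
  · rw [Dt_eq]
    have := h f
    exact nonneg_of_mul_nonneg_right this (V_pos f hf)

lemma Dt_ne_zero_iff {n d : ℕ} (v : Fin n → Fin d → ℝ) (g : Fin d → Fin n) :
    Dt v g ≠ 0 ↔ Submodule.span ℝ (v '' (Set.range g)) = ⊤ := by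
  unfold Dt
  rw [← isUnit_iff_ne_zero, ← Matrix.isUnit_iff_isUnit_det,
    ← Matrix.linearIndependent_rows_iff_isUnit]
  rw [← Set.range_comp]
  change LinearIndependent ℝ (v ∘ g) ↔ _
  constructor
  · intro h
    exact h.span_eq_top_of_card_eq_finrank' (by simp)
  · intro h
    exact linearIndependent_of_top_le_span_of_card_eq_finrank h.ge (by simp)

lemma Dt_inj {n d : ℕ} (v : Fin n → Fin d → ℝ) (g : Fin d → Fin n) (h : Dt v g ≠ 0) :
    Function.Injective g := by
  unfold Dt at h
  intro a b hab
  by_contra hne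
  apply h
  exact Matrix.det_zero_of_row_eq hne (by ext; simp [hab])

end Positroid

namespace Positroid

lemma Dt_cons_smul {n e : ℕ} (v : Fin n → Fin (e + 1) → ℝ) (s : Fin e → Fin n) :
    ∃ L : (Fin (e + 1) → ℝ) →ₗ[ℝ] ℝ, (∀ p, L (v p) = Dt v (Fin.cons p s)) ∧ ∀ t, L (v (s t)) = 0 := by
  let L := (Matrix.detRowAlternating (R := ℝ) (n := Fin (e + 1))).toMultilinearMap.toLinearMap
    (Fin.cons 0 (fun t => v (s t))) 0
  have hL : ∀ u, L u = (Matrix.of (Fin.cons u (fun t => v (s t)) : Fin (e + 1) → Fin (e + 1) → ℝ)).det := by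
    intro u
    simp only [L, MultilinearMap.toLinearMap_apply]
    rw [Fin.update_cons_zero]
    rfl
  have h1 : ∀ p, L (v p) = Dt v (Fin.cons p s) := by
    intro p
    rw [hL]
    unfold Dt
    congr 1
    ext i j
    refine Fin.cases ?_ (fun i => ?_) i <;> simp
  refine ⟨L, h1, fun t => ?_⟩
  rw [h1]
  by_contra h
  have := Dt_inj v _ h (a₁ := 0) (a₂ := t.succ) (by simp)
  exact absurd this (Fin.succ_ne_zero t).symm

lemma cross_aux {n e : ℕ} (v : Fin n → Fin (e + 2) → ℝ) (hN : NN v) (s : Fin e → Fin n)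
    (a b x y : Fin n)
    (hab : v a ∈ Submodule.span ℝ (insert (v b) (v '' Set.range s)))
    (hax : Dt v (Fin.cons a (Fin.cons x s)) ≠ 0)
    (hay : Dt v (Fin.cons a (Fin.cons y s)) ≠ 0)
    (hbx : Dt v (Fin.cons b (Fin.cons x s)) ≠ 0)
    (hby : Dt v (Fin.cons b (Fin.cons y s)) ≠ 0) :
    0 < (((x : ℕ) : ℝ) - (a : ℕ)) * (((x : ℕ) : ℝ) - (b : ℕ)) * (((y : ℕ) : ℝ) - (a : ℕ)) *
      (((y : ℕ) : ℝ) - (b : ℕ)) := by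
  obtain ⟨r, u, hu, hr⟩ := Submodule.mem_span_insert.1 hab
  have key : ∀ z : Fin n, Dt v (Fin.cons a (Fin.cons z s)) = r * Dt v (Fin.cons b (Fin.cons z s)) := by
    intro z
    obtain ⟨L, h1, h2⟩ := Dt_cons_smul v (Fin.cons z s)
    rw [← h1, ← h1, hr]
    have : L u = 0 := by
      have : Submodule.span ℝ (v '' Set.range s) ≤ LinearMap.ker L := by
        rw [Submodule.span_le]
        rintro _ ⟨_, ⟨t, rfl⟩, rfl⟩
        have := h2 t.succ
        simpa using this
      exact this hu
    simp [this]
  have g1 := hN (Fin.cons a (Fin.cons x s))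
  have g2 := hN (Fin.cons b (Fin.cons y s))
  have g3 := hN (Fin.cons a (Fin.cons y s))
  have g4 := hN (Fin.cons b (Fin.cons x s))
  have k1 := (V_ne_zero _).2 (Dt_inj v _ hax)
  have k2 := (V_ne_zero _).2 (Dt_inj v _ hby)
  have k3 := (V_ne_zero _).2 (Dt_inj v _ hay)
  have k4 := (V_ne_zero _).2 (Dt_inj v _ hbx)
  have p1 := lt_of_le_of_ne g1 (mul_ne_zero k1 hax).symm
  have p2 := lt_of_le_of_ne g2 (mul_ne_zero k2 hby).symm
  have p3 := lt_of_le_of_ne g3 (mul_ne_zero k3 hay).symm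
  have p4 := lt_of_le_of_ne g4 (mul_ne_zero k4 hbx).symm
  have pp := mul_pos (mul_pos p1 p2) (mul_pos p3 p4)
  rw [key x, key y] at pp
  simp only [V_cons, Fin.prod_univ_succ, Fin.cons_zero, Fin.cons_succ] at pp
  generalize Dt v (Fin.cons b (Fin.cons x s)) = ox at *
  generalize Dt v (Fin.cons b (Fin.cons y s)) = oy at *
  generalize (∏ t, (((s t : ℕ) : ℝ) - ((a : ℕ) : ℝ))) = Pa at *
  generalize (∏ t, (((s t : ℕ) : ℝ) - ((b : ℕ) : ℝ))) = Pb at *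
  generalize (∏ t, (((s t : ℕ) : ℝ) - ((x : ℕ) : ℝ))) = Px at *
  generalize (∏ t, (((s t : ℕ) : ℝ) - ((y : ℕ) : ℝ))) = Py at *
  generalize V s = Vs at *
  have e : 0 < (((x : ℕ) : ℝ) - (a : ℕ)) * (((x : ℕ) : ℝ) - (b : ℕ)) * (((y : ℕ) : ℝ) - (a : ℕ)) *
      (((y : ℕ) : ℝ) - (b : ℕ)) * (Pa * Pb * Px * Py * Vs * Vs * r * ox * oy) ^ 2 := by
    refine lt_of_lt_of_eq pp ?_
    ring
  exact pos_of_mul_pos_left e (sq_nonneg _)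

lemma cross_finset {n d : ℕ} (v : Fin n → Fin d → ℝ) (hN : NN v) (S : Finset (Fin n))
    (hS : S.card + 2 = d)
    (a b x y : Fin n)
    (hab : v a ∈ Submodule.span ℝ (v '' insert b (S : Set (Fin n))))
    (hax : Submodule.span ℝ (v '' insert a (insert x (S : Set (Fin n)))) = ⊤)
    (hay : Submodule.span ℝ (v '' insert a (insert y (S : Set (Fin n)))) = ⊤)
    (hbx : Submodule.span ℝ (v '' insert b (insert x (S : Set (Fin n)))) = ⊤)
    (hby : Submodule.span ℝ (v '' insert b (insert y (S : Set (Fin n)))) = ⊤) :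
    0 < (((x : ℕ) : ℝ) - (a : ℕ)) * (((x : ℕ) : ℝ) - (b : ℕ)) * (((y : ℕ) : ℝ) - (a : ℕ)) *
      (((y : ℕ) : ℝ) - (b : ℕ)) := by
  subst hS
  have hr : Set.range (S.orderEmbOfFin rfl) = (S : Set (Fin n)) := by simp
  have aux : ∀ p q : Fin n, Submodule.span ℝ (v '' insert p (insert q (S : Set (Fin n)))) = ⊤ →
      Dt v (Fin.cons p (Fin.cons q (S.orderEmbOfFin rfl))) ≠ 0 := by
    intro p q h
    rw [Dt_ne_zero_iff, Fin.range_cons, Fin.range_cons, hr]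
    exact h
  refine cross_aux v hN (S.orderEmbOfFin rfl) a b x y ?_ (aux _ _ hax) (aux _ _ hay) (aux _ _ hbx)
    (aux _ _ hby)
  rw [hr, ← Set.image_insert_eq]
  exact hab

/-- a minimal dependent subset -/
lemma exists_circuit {n d : ℕ} (v : Fin n → Fin d → ℝ) (I : Finset (Fin n))
    (hI : ¬ LinearIndepOn ℝ v (I : Set (Fin n))) :
    ∃ C ⊆ I, C.Nonempty ∧ ∀ c ∈ C, LinearIndepOn ℝ v ((C.erase c : Finset (Fin n)) : Set (Fin n)) ∧
      v c ∈ Submodule.span ℝ (v '' ((C.erase c : Finset (Fin n)) : Set (Fin n))) := by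
  classical
  obtain ⟨C, hC, hmin⟩ := Finset.exists_min_image
    (I.powerset.filter (fun C : Finset (Fin n) => ¬ LinearIndepOn ℝ v (C : Set (Fin n)))) Finset.card
    ⟨I, by simp [hI]⟩
  simp only [Finset.mem_filter, Finset.mem_powerset] at hC hmin
  refine ⟨C, hC.1, ?_, fun c hc => ?_⟩
  · rw [Finset.nonempty_iff_ne_empty]
    rintro rfl
    exact hC.2 (by simp)
  · have h1 : LinearIndepOn ℝ v ((C.erase c : Finset (Fin n)) : Set (Fin n)) := by
      by_contra h
      have := hmin (C.erase c) ⟨(Finset.erase_subset _ _).trans hC.1, h⟩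
      have := Finset.card_erase_lt_of_mem hc
      omega
    refine ⟨h1, ?_⟩
    by_contra h
    apply hC.2
    have := h1.insert h
    rwa [← Finset.coe_insert, Finset.insert_erase hc] at this

/-- the gap map: last element of `C` cyclically before `x` -/
noncomputable def gam {n : ℕ} (C : Finset (Fin n)) (hC : C.Nonempty) (x : Fin n) : Fin n :=
  if h : (C.filter (· < x)).Nonempty then (C.filter (· < x)).max' h else C.max' hC

lemma gam_mem {n : ℕ} (C : Finset (Fin n)) (hC : C.Nonempty) (x : Fin n) : gam C hC x ∈ C := by
  unfold gam
  split_ifs with h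
  · exact (Finset.mem_filter.1 (Finset.max'_mem _ h)).1
  · exact Finset.max'_mem _ hC

lemma gam_sep_aux {n : ℕ} (C : Finset (Fin n)) (hC : C.Nonempty) (x y : Fin n) (hx : x ∉ C)
    (hy : y ∉ C) (h : gam C hC x ≠ gam C hC y) (hxy : x < y) :
    ∃ a ∈ C, ∃ b ∈ C, (x < b ∧ b < y) ∧ (a < x ∨ y < a) := by
  have h1 : ∃ b ∈ C, x < b ∧ b < y := by
    by_contra hcon
    push Not at hcon
    apply h
    have : C.filter (· < x) = C.filter (· < y) := by
      ext c
      simp only [Finset.mem_filter]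
      constructor
      · rintro ⟨hc, h1⟩; exact ⟨hc, h1.trans hxy⟩
      · rintro ⟨hc, h1⟩
        refine ⟨hc, ?_⟩
        by_contra h2
        have h3 : x ≠ c := by rintro rfl; exact hx hc
        exact absurd h1 (not_lt.2 (hcon c hc (lt_of_le_of_ne (not_lt.1 h2) h3)))
    unfold gam
    simp only [this]
  have h2 : ∃ a ∈ C, a < x ∨ y < a := by
    by_contra hcon
    push Not at hcon
    apply h
    have e1 : C.filter (· < x) = ∅ := by
      rw [Finset.filter_eq_empty_iff]
      intro c hc; exact not_lt.2 (hcon c hc).1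
    have e2 : C.filter (· < y) = C := by
      rw [Finset.filter_eq_self]
      intro c hc
      refine lt_of_le_of_ne (hcon c hc).2 ?_
      rintro rfl; exact hy hc
    unfold gam
    simp only [e1, e2]
    simp [hC]
  obtain ⟨b, hb, hb'⟩ := h1
  obtain ⟨a, ha, ha'⟩ := h2
  exact ⟨a, ha, b, hb, hb', ha'⟩

lemma gam_sep {n : ℕ} (C : Finset (Fin n)) (hC : C.Nonempty) (x y : Fin n) (hx : x ∉ C)
    (hy : y ∉ C) (h : gam C hC x ≠ gam C hC y) :
    ∃ a ∈ C, ∃ b ∈ C, a ≠ b ∧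
    (((x : ℕ) : ℝ) - (a : ℕ)) * (((x : ℕ) : ℝ) - (b : ℕ)) * (((y : ℕ) : ℝ) - (a : ℕ)) *
      (((y : ℕ) : ℝ) - (b : ℕ)) < 0 := by
  have aux : ∀ x y a b : Fin n, x < y → (x < b ∧ b < y) ∧ (a < x ∨ y < a) →
      a ≠ b ∧ (((x : ℕ) : ℝ) - (a : ℕ)) * (((x : ℕ) : ℝ) - (b : ℕ)) * (((y : ℕ) : ℝ) - (a : ℕ)) *
      (((y : ℕ) : ℝ) - (b : ℕ)) < 0 := by
    intro x y a b hxy ⟨⟨h1, h2⟩, h3⟩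
    have cast : ∀ p q : Fin n, p < q → 0 < ((q : ℕ) : ℝ) - (p : ℕ) := by
      intro p q hpq
      have : ((p : ℕ) : ℝ) < ((q : ℕ) : ℝ) := by exact_mod_cast hpq
      linarith
    have c1 := cast _ _ h1
    have c2 := cast _ _ h2
    rcases h3 with h3 | h3
    · refine ⟨(h3.trans h1).ne, ?_⟩
      have c3 := cast _ _ h3
      have c4 := cast _ _ (h3.trans hxy)
      nlinarith [mul_pos (mul_pos c1 c2) (mul_pos c3 c4)]
    · refine ⟨(h2.trans h3).ne', ?_⟩
      have c3 := cast _ _ h3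
      have c4 := cast _ _ (hxy.trans h3)
      nlinarith [mul_pos (mul_pos c1 c2) (mul_pos c3 c4)]
  rcases lt_trichotomy x y with hxy | hxy | hxy
  · obtain ⟨a, ha, b, hb, hh⟩ := gam_sep_aux C hC x y hx hy h hxy
    exact ⟨a, ha, b, hb, aux x y a b hxy hh⟩
  · subst hxy; exact absurd rfl h
  · obtain ⟨a, ha, b, hb, hh⟩ := gam_sep_aux C hC y x hy hx h.symm hxy
    refine ⟨a, ha, b, hb, (aux y x a b hxy hh).1, ?_⟩
    have := (aux y x a b hxy hh).2
    nlinarith [this]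

/-- The complement of a gap is a cyclic interval. -/
lemma gap_compl {n : ℕ} (C : Finset (Fin n)) (hC : C.Nonempty) (c : Fin n) (hc : c ∈ C) :
    (∃ a b : Fin n, a ≤ b ∧ ∀ x, ¬ (x ∉ C ∧ gam C hC x = c) ↔ a ≤ x ∧ x ≤ b) ∨
    (∃ a b : Fin n, a < b ∧ ∀ x, ¬ (x ∉ C ∧ gam C hC x = c) ↔ x ≤ a ∨ b ≤ x) := by
  by_cases hmax : c = C.max' hC
  · left
    refine ⟨C.min' hC, C.max' hC, Finset.min'_le_max' C hC, fun x => ?_⟩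
    constructor
    · intro h
      by_contra h2
      have hxC : x ∉ C := fun hx => h2 ⟨Finset.min'_le _ _ hx, Finset.le_max' _ _ hx⟩
      apply h
      refine ⟨hxC, ?_⟩
      rw [hmax]
      rw [not_and_or, not_le, not_le] at h2
      rcases h2 with h2 | h2
      · have e1 : C.filter (· < x) = ∅ := by
          rw [Finset.filter_eq_empty_iff]
          intro y hy; exact not_lt.2 (h2.le.trans (Finset.min'_le _ _ hy))
        unfold gam; simp [e1]
      · have e2 : C.filter (· < x) = C := by
          rw [Finset.filter_eq_self]
          intro y hy
          exact (Finset.le_max' _ _ hy).trans_lt h2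
        unfold gam; simp only [e2]; simp [hC]
    · rintro ⟨h1, h2⟩ ⟨h3, h4⟩
      have h1' : C.min' hC < x := lt_of_le_of_ne h1 (by rintro rfl; exact h3 (Finset.min'_mem _ _))
      have h2' : x < C.max' hC := lt_of_le_of_ne h2 (by rintro rfl; exact h3 (Finset.max'_mem _ _))
      have hne : (C.filter (· < x)).Nonempty := ⟨C.min' hC, by simp [h1', Finset.min'_mem]⟩
      unfold gam at h4
      rw [dif_pos hne] at h4
      have := (Finset.mem_filter.1 (Finset.max'_mem _ hne)).2
      rw [h4, hmax] at this
      exact absurd this (not_lt.2 h2)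
  · right
    have hlt : c < C.max' hC := lt_of_le_of_ne (Finset.le_max' _ _ hc) hmax
    have hne : (C.filter (c < ·)).Nonempty := ⟨C.max' hC, by simp [hlt, Finset.max'_mem]⟩
    have hm := Finset.mem_filter.1 (Finset.min'_mem _ hne)
    refine ⟨c, (C.filter (c < ·)).min' hne, hm.2, fun x => ?_⟩
    constructor
    · intro h
      by_contra h2
      push Not at h2
      have key : ∀ y ∈ C, y < x → y ≤ c := by
        intro y hy hyx
        by_contra h5
        have := Finset.min'_le (C.filter (c < ·)) y (by simp [hy, not_le.1 h5])
        exact absurd (this.trans hyx.le) (not_le.2 h2.2)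
      have hxC : x ∉ C := fun hx => by
        have := Finset.min'_le (C.filter (c < ·)) x (by simp [hx, h2.1])
        exact absurd this (not_le.2 h2.2)
      apply h
      refine ⟨hxC, ?_⟩
      have hne2 : (C.filter (· < x)).Nonempty := ⟨c, by simp [hc, h2.1]⟩
      unfold gam
      rw [dif_pos hne2]
      apply le_antisymm
      · apply Finset.max'_le
        intro y hy
        rw [Finset.mem_filter] at hy
        exact key y hy.1 hy.2
      · exact Finset.le_max' _ _ (by simp [hc, h2.1])
    · rintro h ⟨h3, h4⟩
      unfold gam at h4
      split_ifs at h4 with hne2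
      · have hcx := Finset.mem_filter.1 (Finset.max'_mem _ hne2)
        rw [h4] at hcx
        rcases h with h | h
        · exact absurd hcx.2 (not_lt.2 h)
        · have h' : (C.filter (c < ·)).min' hne < x :=
            lt_of_le_of_ne h (by rintro rfl; exact h3 hm.1)
          have := Finset.le_max' (C.filter (· < x)) _ (Finset.mem_filter.2 ⟨hm.1, h'⟩)
          rw [h4] at this
          exact absurd hm.2 (not_lt.2 this)
      · exact hmax h4.symm

end Positroid

namespace Positroid

lemma span_erase {n d : ℕ} (v : Fin n → Fin d → ℝ) (C Q : Finset (Fin n)) (b : Fin n)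
    (hb : v b ∈ Submodule.span ℝ (v '' ((C.erase b : Finset (Fin n)) : Set (Fin n)))) :
    Submodule.span ℝ (v '' ((C ∪ Q : Finset (Fin n)) : Set (Fin n))) ≤
      Submodule.span ℝ (v '' ((C.erase b ∪ Q : Finset (Fin n)) : Set (Fin n))) := by
  rw [Submodule.span_le]
  rintro _ ⟨z, hz, rfl⟩
  by_cases hzb : z = b
  · subst hzb
    refine Submodule.span_mono (Set.image_mono ?_) hb
    exact_mod_cast Finset.subset_union_left
  · apply Submodule.subset_span
    refine ⟨z, ?_, rfl⟩
    simp only [Finset.coe_union, Set.mem_union, Finset.mem_coe, Finset.mem_erase] at hz ⊢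
    tauto

lemma set_aux {n : ℕ} (C B : Finset (Fin n)) (p q z x w : Fin n)
    (hw : w ∈ C.erase q ∪ insert z (B.erase x)) :
    w = p ∨ w = z ∨ w ∈ (C.erase p).erase q ∪ B.erase x := by
  simp only [Finset.mem_union, Finset.mem_insert, Finset.mem_erase] at hw ⊢
  tauto

theorem exists_interval {n d : ℕ} (v : Fin n → Fin d → ℝ) (hSp : Sp v) (hN : NN v)
    (I : Finset (Fin n)) (hI : I.card = d) (hdep : ¬ LinearIndepOn ℝ v (I : Set (Fin n))) :
    ∃ J : Finset (Fin n), ((∃ a b : Fin n, a ≤ b ∧ ∀ x, x ∈ J ↔ a ≤ x ∧ x ≤ b) ∨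
      (∃ a b : Fin n, a < b ∧ ∀ x, x ∈ J ↔ x ≤ a ∨ b ≤ x)) ∧
      Module.finrank ℝ (Submodule.span ℝ (v '' (J : Set (Fin n)))) < (I ∩ J).card := by
  classical
  obtain ⟨C, hCI, hC, hcirc⟩ := exists_circuit v I hdep
  obtain ⟨c0, hc0⟩ := id hC
  obtain ⟨T, hCT, -, hT, hTs⟩ := extend v (C.erase c0) univ (Finset.subset_univ _) (hcirc c0 hc0).1
  have hTs : Submodule.span ℝ (v '' (T : Set (Fin n))) = ⊤ := by
    rw [← hTs, Finset.coe_univ, Set.image_univ]; exact hSp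
  have hTd : T.card = d := by
    rw [← finrank_indep v T hT, hTs]; simp
  have hc0T : c0 ∉ T := by
    intro h
    have h1 : insert c0 ((T.erase c0 : Finset (Fin n)) : Set (Fin n)) = (T : Set (Fin n)) := by
      rw [← Finset.coe_insert, Finset.insert_erase h]
    have h2 := LinearIndepOn.notMem_span_of_insert (h1 ▸ hT) (by simp)
    apply h2
    refine Submodule.span_mono (Set.image_mono ?_) (hcirc c0 hc0).2
    intro z hz
    simp only [Finset.coe_erase, Set.mem_sdiff, Finset.mem_coe, Set.mem_singleton_iff] at hz ⊢
    exact ⟨hCT (by simp [hz]), hz.2⟩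
  set B := T \ C with hB
  have hTB : T = C.erase c0 ∪ B := by
    ext z
    simp only [hB, Finset.mem_union, Finset.mem_erase, Finset.mem_sdiff]
    constructor
    · intro hz
      by_cases hzC : z ∈ C
      · left; exact ⟨by rintro rfl; exact hc0T hz, hzC⟩
      · right; exact ⟨hz, hzC⟩
    · rintro (hz | hz)
      · exact hCT (by simp [hz])
      · exact hz.1
  have hBC : Disjoint C B := Finset.disjoint_sdiff
  have hcard : C.card - 1 + B.card = d := by
    rw [← hTd, hTB, Finset.card_union_of_disjoint (hBC.mono_left (Finset.erase_subset _ _)),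
      Finset.card_erase_of_mem hc0]
  have hCpos : 0 < C.card := hC.card_pos
  -- the main claim
  have claim : ∀ y, y ∉ C → v y ∈ Submodule.span ℝ
      (v '' ((C ∪ B.filter (fun x => gam C hC x = gam C hC y) : Finset (Fin n)) : Set (Fin n))) := by
    intro y hy
    by_cases hyT : y ∈ T
    · apply Submodule.subset_span
      refine ⟨y, ?_, rfl⟩
      simp [hB, hyT, hy]
    have hyt : v y ∈ Submodule.span ℝ (v '' (T : Set (Fin n))) := by rw [hTs]; trivial
    rw [Submodule.mem_span_image_finset_iff_exists_fun'] at hyt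
    obtain ⟨c, hc⟩ := hyt
    have hzero : ∀ x ∈ B, gam C hC x ≠ gam C hC y → c x = 0 := by
      intro x hx hxy
      by_contra hcx
      have hxC : x ∉ C := (Finset.mem_sdiff.1 hx).2
      have hxT : x ∈ T := (Finset.mem_sdiff.1 hx).1
      obtain ⟨a, ha, b, hb, hab, hneg⟩ := gam_sep C hC x y hxC hy hxy
      -- v x in span of T.erase x and y
      have hvx : v x ∈ Submodule.span ℝ (v '' (insert y ((T.erase x : Finset (Fin n)) : Set (Fin n)))) := by
        have : c x • v x = v y - ∑ i ∈ T.erase x, c i • v i := by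
          rw [← hc, ← Finset.add_sum_erase T _ hxT]; simp
        have h2 : v x = (c x)⁻¹ • (v y - ∑ i ∈ T.erase x, c i • v i) := by
          rw [← this, smul_smul, inv_mul_cancel₀ hcx, one_smul]
        rw [h2]
        refine Submodule.smul_mem _ _ (Submodule.sub_mem _ ?_ (Submodule.sum_mem _ fun i hi => ?_))
        · exact Submodule.subset_span ⟨y, by simp, rfl⟩
        · exact Submodule.smul_mem _ _ (Submodule.subset_span ⟨i, Or.inr hi, rfl⟩)
      have top1 : Submodule.span ℝ (v '' ((C ∪ B : Finset (Fin n)) : Set (Fin n))) = ⊤ := by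
        rw [eq_top_iff, ← hTs, hTB]
        refine Submodule.span_mono (Set.image_mono ?_)
        exact_mod_cast Finset.union_subset_union_left (Finset.erase_subset _ _)
      have top2 : Submodule.span ℝ (v '' ((C ∪ insert y (B.erase x) : Finset (Fin n)) : Set (Fin n))) = ⊤ := by
        rw [eq_top_iff, ← hTs, Submodule.span_le]
        have hsub : insert y ((T.erase x : Finset (Fin n)) : Set (Fin n)) ⊆
            ((C ∪ insert y (B.erase x) : Finset (Fin n)) : Set (Fin n)) := by
          intro z hz
          rcases hz with rfl | hz
          · simp
          · have hz1 := Finset.mem_erase.1 hz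
            by_cases hzC : z ∈ C
            · simp [hzC]
            · simp [hB, hz1.1, hz1.2, hzC]
        rintro _ ⟨z, hz, rfl⟩
        by_cases hzx : z = x
        · subst hzx
          exact Submodule.span_mono (Set.image_mono hsub) hvx
        · apply Submodule.subset_span
          refine ⟨z, hsub ?_, rfl⟩
          right
          simpa [hzx] using hz
      set S := (C.erase a).erase b ∪ B.erase x with hSdef
      have hdis : Disjoint ((C.erase a).erase b) (B.erase x) :=
        hBC.mono ((Finset.erase_subset _ _).trans (Finset.erase_subset _ _)) (Finset.erase_subset _ _)
      have hba : b ∈ C.erase a := Finset.mem_erase.2 ⟨hab.symm, hb⟩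
      have hScard : S.card + 2 = d := by
        rw [hSdef, Finset.card_union_of_disjoint hdis, Finset.card_erase_of_mem hba,
          Finset.card_erase_of_mem ha, Finset.card_erase_of_mem hx]
        have h1 : 0 < B.card := Finset.card_pos.2 ⟨x, hx⟩
        have h2 : 1 < C.card := Finset.one_lt_card.2 ⟨a, ha, b, hb, hab⟩
        omega
      have spans : ∀ p q z, p ∈ C → q ∈ C → p ≠ q → (p = a ∧ q = b ∨ p = b ∧ q = a) →
          Submodule.span ℝ (v '' ((C ∪ insert z (B.erase x) : Finset (Fin n)) : Set (Fin n))) = ⊤ →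
          Submodule.span ℝ (v '' insert p (insert z (S : Set (Fin n)))) = ⊤ := by
        intro p q z hp hq hpq hh htop
        have := span_erase v C (insert z (B.erase x)) q (hcirc q hq).2
        rw [htop, top_le_iff] at this
        rw [eq_top_iff, ← this]
        refine Submodule.span_mono (Set.image_mono ?_)
        intro w hw
        have h3 := set_aux C B p q z x w hw
        rcases hh with ⟨rfl, rfl⟩ | ⟨rfl, rfl⟩
        · exact h3
        · rw [Finset.erase_right_comm] at h3
          exact h3
      have top1' : Submodule.span ℝ (v '' ((C ∪ insert x (B.erase x) : Finset (Fin n)) : Set (Fin n))) = ⊤ := by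
        rw [Finset.insert_erase hx]; exact top1
      have := cross_finset v hN S hScard a b x y ?_
        (spans a b x ha hb hab (Or.inl ⟨rfl, rfl⟩) top1') (spans a b y ha hb hab (Or.inl ⟨rfl, rfl⟩) top2)
        (spans b a x hb ha hab.symm (Or.inr ⟨rfl, rfl⟩) top1') (spans b a y hb ha hab.symm (Or.inr ⟨rfl, rfl⟩) top2)
      · linarith
      · refine Submodule.span_mono (Set.image_mono ?_) (hcirc a ha).2
        intro w hw
        by_cases hwb : w = b
        · exact Or.inl hwb
        · exact Or.inr (Finset.mem_union_left _ (Finset.mem_erase.2 ⟨hwb, hw⟩))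
    rw [← hc]
    refine Submodule.sum_mem _ fun i hi => ?_
    by_cases hiC : i ∈ C
    · exact Submodule.smul_mem _ _ (Submodule.subset_span ⟨i, by simp [hiC], rfl⟩)
    · have hiB : i ∈ B := Finset.mem_sdiff.2 ⟨hi, hiC⟩
      by_cases hig : gam C hC i = gam C hC y
      · exact Submodule.smul_mem _ _ (Submodule.subset_span ⟨i, by simp [hiB, hig], rfl⟩)
      · rw [hzero i hiB hig]; simp
  -- choose the gap
  have hcount : ∃ c ∈ C, ((I \ C).filter (fun x => gam C hC x = c)).card <
      (B.filter (fun x => gam C hC x = c)).card := by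
    apply Finset.exists_lt_of_sum_lt
    rw [← Finset.card_eq_sum_card_fiberwise (fun x _ => gam_mem C hC x),
      ← Finset.card_eq_sum_card_fiberwise (fun x _ => gam_mem C hC x),
      Finset.card_sdiff_of_subset hCI]
    have := Finset.card_le_card hCI
    omega
  obtain ⟨c, hcC, hlt⟩ := hcount
  refine ⟨univ.filter (fun x => ¬ (x ∉ C ∧ gam C hC x = c)), ?_, ?_⟩
  · have := gap_compl C hC c hcC
    simpa only [Finset.mem_filter, Finset.mem_univ, true_and] using this
  · have h1 : Submodule.span ℝ (v '' ((univ.filter (fun x => ¬ (x ∉ C ∧ gam C hC x = c)) :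
        Finset (Fin n)) : Set (Fin n))) ≤ Submodule.span ℝ
        (v '' ((T \ B.filter (fun x => gam C hC x = c) : Finset (Fin n)) : Set (Fin n))) := by
      have hCs : ∀ z ∈ C, v z ∈ Submodule.span ℝ
        (v '' ((T \ B.filter (fun x => gam C hC x = c) : Finset (Fin n)) : Set (Fin n))) := by
        intro z hz
        have hsub : ((C.erase c0 : Finset (Fin n)) : Set (Fin n)) ⊆
            ((T \ B.filter (fun x => gam C hC x = c) : Finset (Fin n)) : Set (Fin n)) := by
          intro w hw
          have hw1 := hCT hw
          have hw2 : w ∈ C := Finset.mem_of_mem_erase hw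
          simp [hw1, hB, hw2]
        by_cases hz0 : z = c0
        · subst hz0
          exact Submodule.span_mono (Set.image_mono hsub) (hcirc z hz).2
        · exact Submodule.subset_span ⟨z, hsub (by simp [hz, hz0]), rfl⟩
      rw [Submodule.span_le]
      rintro _ ⟨x, hx, rfl⟩
      simp only [Finset.coe_filter, Finset.mem_univ, true_and, Set.mem_ofPred_eq, not_and] at hx
      by_cases hxC : x ∈ C
      · exact hCs x hxC
      · have hx' := hx hxC
        have := claim x hxC
        refine (Submodule.span_le.2 ?_) this
        rintro _ ⟨z, hz, rfl⟩
        rcases Finset.mem_union.1 hz with hz | hz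
        · exact hCs z hz
        · rw [Finset.mem_filter] at hz
          apply Submodule.subset_span
          refine ⟨z, ?_, rfl⟩
          have : gam C hC z ≠ c := by rw [hz.2]; exact hx'
          simp [this, (Finset.mem_sdiff.1 hz.1).1]
    have h2 := (Submodule.finrank_mono h1).trans (finrank_le v _)
    refine h2.trans_lt ?_
    have hsubT : B.filter (fun x => gam C hC x = c) ⊆ T :=
      (Finset.filter_subset _ _).trans Finset.sdiff_subset
    rw [Finset.card_sdiff_of_subset hsubT, hTd]
    have h3 : (I ∩ univ.filter (fun x => ¬ (x ∉ C ∧ gam C hC x = c))).card +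
        ((I \ C).filter (fun x => gam C hC x = c)).card = d := by
      rw [← hI, ← Finset.card_filter_add_card_filter_not (s := I) (fun x => ¬ (x ∉ C ∧ gam C hC x = c))]
      congr 2
      · ext x; simp
      · ext x; simp [and_assoc]
    have h4 : (B.filter (fun x => gam C hC x = c)).card ≤ d := by
      rw [← hTd]; exact Finset.card_le_card hsubT
    omega

end Positroid

namespace Positroid

/-- periodic extension of the columns -/
def W {n d : ℕ} [NeZero n] (v : Fin n → Fin d → ℝ) (m : ℕ) : Fin d → ℝ := v (Fin.ofNat n m)

/-- span of the columns with position in `(k, l]` -/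
def SP {n d : ℕ} [NeZero n] (v : Fin n → Fin d → ℝ) (k l : ℕ) : Submodule ℝ (Fin d → ℝ) :=
  Submodule.span ℝ (W v '' Set.Ioc k l)

/-- the bounded affine permutation of a vector configuration -/
noncomputable def F {n d : ℕ} [NeZero n] (v : Fin n → Fin d → ℝ) (k : ℕ) : ℕ :=
  sInf {l | k ≤ l ∧ W v k ∈ SP v k l}

section
variable {n d : ℕ} [NeZero n] (v : Fin n → Fin d → ℝ)

lemma W_add (m : ℕ) : W v (m + n) = W v m := by
  unfold W
  congr 1
  apply Fin.ext
  simp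

lemma W_lt (m : ℕ) (h : m < n) : W v m = v ⟨m, h⟩ := by
  unfold W
  congr 1
  apply Fin.ext
  simp [Nat.mod_eq_of_lt h]

lemma W_fin (k : Fin n) : W v (k : ℕ) = v k := W_lt v k k.2

lemma SP_mono {k l k' l' : ℕ} (hk : k' ≤ k) (hl : l ≤ l') : SP v k l ≤ SP v k' l' :=
  Submodule.span_mono (Set.image_mono (Set.Ioc_subset_Ioc hk hl))

lemma F_set_ne (k : ℕ) : k + n ∈ {l | k ≤ l ∧ W v k ∈ SP v k l} := by
  refine ⟨by omega, Submodule.subset_span ⟨k + n, ?_, W_add v k⟩⟩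
  have := NeZero.pos n
  simp [this]

lemma F_le (k : ℕ) : F v k ≤ k + n := Nat.sInf_le (F_set_ne v k)

lemma F_spec (k : ℕ) : k ≤ F v k ∧ W v k ∈ SP v k (F v k) :=
  Nat.sInf_mem (s := {l | k ≤ l ∧ W v k ∈ SP v k l}) ⟨_, F_set_ne v k⟩

lemma F_iff (k l : ℕ) (h : k ≤ l) : F v k ≤ l ↔ W v k ∈ SP v k l := by
  constructor
  · intro h1; exact SP_mono v le_rfl h1 (F_spec v k).2
  · intro h1; exact Nat.sInf_le ⟨h, h1⟩

lemma SP_add (k l : ℕ) : SP v (k + n) (l + n) = SP v k l := by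
  unfold SP
  congr 1
  ext x
  constructor
  · rintro ⟨m, hm, rfl⟩
    simp only [Set.mem_Ioc] at hm
    refine ⟨m - n, by simp only [Set.mem_Ioc]; omega, ?_⟩
    rw [← W_add]
    congr 1; omega
  · rintro ⟨m, hm, rfl⟩
    simp only [Set.mem_Ioc] at hm
    exact ⟨m + n, by simp only [Set.mem_Ioc]; omega, W_add v m⟩

lemma F_add (k : ℕ) : F v (k + n) = F v k + n := by
  have h : ∀ l, k ≤ l → (F v (k + n) ≤ l + n ↔ F v k ≤ l) := by
    intro l hl
    rw [F_iff v k l hl, F_iff v (k + n) (l + n) (by omega), SP_add, W_add]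
  apply le_antisymm
  · exact (h _ (F_spec v k).1).2 le_rfl
  · have h0 := (F_spec v (k + n)).1
    have := (h (F v (k + n) - n) (by omega)).1 (by omega)
    omega

lemma F_add_mul (k a : ℕ) : F v (k + n * a) = F v k + n * a := by
  induction a with
  | zero => simp
  | succ a ih =>
    have : k + n * (a + 1) = (k + n * a) + n := by ring
    rw [this, F_add, ih]; ring

lemma SP_succ (k j : ℕ) (h : k ≤ j) :
    SP v k (j + 1) = Submodule.span ℝ (insert (W v (j + 1)) (W v '' Set.Ioc k j)) := by
  unfold SP
  rw [← Set.image_insert_eq]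
  congr 2
  ext m
  simp only [Set.mem_Ioc, Set.mem_insert_iff]
  omega

lemma F_inj_aux (p q : ℕ) (hpq : p < q) (h : F v p = F v q) : False := by
  have hq := (F_spec v q).1
  obtain ⟨j, hj⟩ : ∃ j, F v q = j + 1 := ⟨F v q - 1, by omega⟩
  have h1 : W v p ∈ SP v p (j + 1) := by
    rw [← F_iff v p (j + 1) (by omega)]; omega
  have h2 : W v p ∉ SP v p j := by
    rw [← F_iff v p j (by omega)]; omega
  have h3 : W v (j + 1) ∈ SP v p j := by
    by_cases hqj : q = j + 1
    · have : W v q ∈ SP v q q := by rw [← F_iff v q q le_rfl]; omega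
      have h0 : W v q = 0 := by
        unfold SP at this
        simpa using this
      rw [← hqj, h0]; exact Submodule.zero_mem _
    · have h4 : W v q ∈ SP v q (j + 1) := by
        rw [← F_iff v q (j + 1) (by omega)]; omega
      have h5 : W v q ∉ SP v q j := by
        rw [← F_iff v q j (by omega)]; omega
      rw [SP_succ v q j (by omega)] at h4
      have := mem_span_insert_exchange h4 h5
      refine (Submodule.span_le.2 ?_) this
      rintro _ (rfl | ⟨m, hm, rfl⟩)
      · exact Submodule.subset_span ⟨q, by simp only [Set.mem_Ioc]; omega, rfl⟩
      · simp only [Set.mem_Ioc] at hm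
        exact Submodule.subset_span ⟨m, by simp only [Set.mem_Ioc]; omega, rfl⟩
  apply h2
  rw [SP_succ v p j (by omega)] at h1
  refine (Submodule.span_le.2 ?_) h1
  rintro _ (rfl | hm)
  · exact h3
  · exact Submodule.subset_span hm

lemma F_inj (p q : ℕ) (h : F v p = F v q) : p = q := by
  rcases lt_trichotomy p q with h1 | h1 | h1
  · exact (F_inj_aux v p q h1 h).elim
  · exact h1
  · exact (F_inj_aux v q p h1 h.symm).elim

lemma F_mod_inj (p q : ℕ) (hp : p < n) (hq : q < n) (h : F v p % n = F v q % n) : p = q := by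
  have h1 := Nat.mod_add_div (F v p) n
  have h2 := Nat.mod_add_div (F v q) n
  have h3 : F v (p + n * (F v q / n)) = F v (q + n * (F v p / n)) := by
    rw [F_add_mul, F_add_mul]; omega
  have h4 := F_inj v _ _ h3
  have h5 : (p + n * (F v q / n)) % n = (q + n * (F v p / n)) % n := by rw [h4]
  simpa [Nat.mod_eq_of_lt hp, Nat.mod_eq_of_lt hq] using h5

/-- rank of the positions in `[a, b)` -/
noncomputable def R (a b : ℕ) : ℕ := Module.finrank ℝ (Submodule.span ℝ (W v '' Set.Ico a b))

lemma finrank_insert {V : Type*} [AddCommGroup V] [Module ℝ V] [FiniteDimensional ℝ V]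
    (x : V) (S : Set V) [Decidable (x ∈ Submodule.span ℝ S)] :
    Module.finrank ℝ (Submodule.span ℝ (insert x S)) =
      Module.finrank ℝ (Submodule.span ℝ S) + if x ∈ Submodule.span ℝ S then 0 else 1 := by
  split_ifs with h
  · rw [Submodule.span_insert_eq_span h]; rfl
  · have hx : x ≠ 0 := by rintro rfl; exact h (Submodule.zero_mem _)
    rw [Submodule.span_insert]
    have h1 := Submodule.finrank_sup_add_finrank_inf_eq (Submodule.span ℝ {x}) (Submodule.span ℝ S)
    have h2 : Submodule.span ℝ {x} ⊓ Submodule.span ℝ S = ⊥ := by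
      rw [← disjoint_iff]
      exact ((Submodule.disjoint_span_singleton' hx).2 h).symm
    rw [h2, finrank_bot, finrank_span_singleton hx] at h1
    omega

open Classical in
lemma R_succ (a b : ℕ) (h : a < b) :
    R v a b = R v (a + 1) b + if F v a < b then 0 else 1 := by
  unfold R
  have e1 : W v '' Set.Ico a b = insert (W v a) (W v '' Set.Ico (a + 1) b) := by
    rw [← Set.image_insert_eq]
    congr 1
    ext m
    simp only [Set.mem_Ico, Set.mem_insert_iff]
    omega
  rw [e1, finrank_insert]
  congr 1
  have e2 : F v a < b ↔ W v a ∈ Submodule.span ℝ (W v '' Set.Ico (a + 1) b) := by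
    obtain ⟨b, rfl⟩ : ∃ b', b = b' + 1 := ⟨b - 1, by omega⟩
    rw [Nat.lt_succ_iff, F_iff v a b (by omega)]
    unfold SP
    have : Set.Ico (a + 1) (b + 1) = Set.Ioc a b := by
      ext m; simp only [Set.mem_Ico, Set.mem_Ioc]; omega
    rw [this]
  simp only [e2]

end

lemma R_eq {n d d' : ℕ} [NeZero n] (v : Fin n → Fin d → ℝ) (vp : Fin n → Fin d' → ℝ)
    (h : ∀ k, k < n → F v k = F vp k) (a b : ℕ) : R v a b = R vp a b := by
  have hF : ∀ k, F v k = F vp k := by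
    intro k
    have h1 := Nat.mod_add_div k n
    rw [← h1, F_add_mul, F_add_mul, h _ (Nat.mod_lt _ (NeZero.pos n))]
  induction hm : b - a generalizing a with
  | zero =>
    have : Set.Ico a b = ∅ := Set.Ico_eq_empty (by omega)
    unfold R
    rw [this, Set.image_empty, Set.image_empty, Submodule.span_empty, Submodule.span_empty,
      finrank_bot, finrank_bot]
  | succ m ih =>
    rw [R_succ v a b (by omega), R_succ vp a b (by omega), ih (a + 1) (by omega), hF]

lemma interval_img {n : ℕ} [NeZero n] (J : Finset (Fin n))
    (hJ : (∃ a b : Fin n, a ≤ b ∧ ∀ x, x ∈ J ↔ a ≤ x ∧ x ≤ b) ∨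
      (∃ a b : Fin n, a < b ∧ ∀ x, x ∈ J ↔ x ≤ a ∨ b ≤ x)) :
    ∃ a b : ℕ, ∀ (d : ℕ) (v : Fin n → Fin d → ℝ), v '' (J : Set (Fin n)) = W v '' Set.Ico a b := by
  rcases hJ with ⟨a, b, hab, h⟩ | ⟨a, b, hab, h⟩
  · refine ⟨a, b + 1, fun d v => ?_⟩
    ext z
    constructor
    · rintro ⟨x, hx, rfl⟩
      have := (h x).1 hx
      refine ⟨x, ?_, W_fin v x⟩
      simp only [Set.mem_Ico]
      have h1 : (a : ℕ) ≤ x := this.1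
      have h2 : (x : ℕ) ≤ b := this.2
      omega
    · rintro ⟨m, hm, rfl⟩
      simp only [Set.mem_Ico] at hm
      have hmn : m < n := by have := b.2; omega
      refine ⟨⟨m, hmn⟩, ?_, (W_lt v m hmn).symm⟩
      exact (h _).2 ⟨Fin.le_def.2 hm.1, Fin.le_def.2 (Nat.lt_succ_iff.1 hm.2)⟩
  · refine ⟨b, a + n + 1, fun d v => ?_⟩
    have hb := b.2
    have ha := a.2
    have hab' : (a : ℕ) < b := hab
    ext z
    constructor
    · rintro ⟨x, hx, rfl⟩
      have hxn := x.2
      rcases (h x).1 hx with h1 | h1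
      · have h1 : (x : ℕ) ≤ a := h1
        refine ⟨x + n, ?_, by rw [W_add, W_fin]⟩
        simp only [Set.mem_Ico]; omega
      · have h1 : (b : ℕ) ≤ x := h1
        refine ⟨x, ?_, by rw [W_fin]⟩
        simp only [Set.mem_Ico]; omega
    · rintro ⟨m, hm, rfl⟩
      simp only [Set.mem_Ico] at hm
      by_cases hmn : m < n
      · refine ⟨⟨m, hmn⟩, ?_, (W_lt v m hmn).symm⟩
        exact (h _).2 (Or.inr (Fin.le_def.2 hm.1))
      · refine ⟨⟨m - n, by omega⟩, ?_, ?_⟩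
        · exact (h _).2 (Or.inl (Fin.le_def.2 (by simp only; omega)))
        · rw [← W_lt v (m - n) (by omega), ← W_add]
          congr 1; omega

lemma R_all {n d : ℕ} [NeZero n] (v : Fin n → Fin d → ℝ) (h : Sp v) : R v 0 n = d := by
  unfold R
  have : W v '' Set.Ico 0 n = Set.range v := by
    ext z
    constructor
    · rintro ⟨m, hm, rfl⟩
      exact ⟨_, rfl⟩
    · rintro ⟨x, rfl⟩
      exact ⟨x, by simp, W_fin v x⟩
  rw [this, h]; simp

theorem indep_of_F {n d : ℕ} [NeZero n] (v vp : Fin n → Fin d → ℝ)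
    (hS : Sp v) (hN : NN v) (h : ∀ k, k < n → F v k = F vp k) (B : Finset (Fin n)) (hB : B.card = d)
    (hi : LinearIndepOn ℝ vp (B : Set (Fin n))) : LinearIndepOn ℝ v (B : Set (Fin n)) := by
  classical
  by_contra hcon
  obtain ⟨J, hJ, hlt⟩ := exists_interval v hS hN B hB hcon
  obtain ⟨a, b, hab⟩ := interval_img J hJ
  have h1 := R_eq v vp h a b
  unfold R at h1
  rw [← hab, ← hab] at h1
  rw [h1] at hlt
  have h2 : LinearIndepOn ℝ vp ((B ∩ J : Finset (Fin n)) : Set (Fin n)) :=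
    hi.mono (by simp)
  have h3 := finrank_indep vp _ h2
  have h4 : Module.finrank ℝ (Submodule.span ℝ (vp '' ((B ∩ J : Finset (Fin n)) : Set (Fin n)))) ≤
      Module.finrank ℝ (Submodule.span ℝ (vp '' (J : Set (Fin n)))) :=
    Submodule.finrank_mono (Submodule.span_mono (Set.image_mono (by simp)))
  omega

/-- bases determine independence, hence spans -/
lemma indep_iff_basis {n d : ℕ} (v : Fin n → Fin d → ℝ) (hS : Sp v) (S : Finset (Fin n)) :
    LinearIndepOn ℝ v (S : Set (Fin n)) ↔
      ∃ B : Finset (Fin n), S ⊆ B ∧ B.card = d ∧ LinearIndepOn ℝ v (B : Set (Fin n)) := by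
  constructor
  · intro h
    obtain ⟨T, h1, -, h2, h3⟩ := extend v S univ (Finset.subset_univ _) h
    refine ⟨T, h1, ?_, h2⟩
    rw [← finrank_indep v T h2, ← h3, Finset.coe_univ, Set.image_univ, hS]; simp
  · rintro ⟨B, h1, -, h2⟩
    exact h2.mono (by exact_mod_cast h1)

lemma span_of_bases {n d d' : ℕ} (v : Fin n → Fin d → ℝ) (vp : Fin n → Fin d' → ℝ)
    (hI : ∀ S : Finset (Fin n), LinearIndepOn ℝ v (S : Set (Fin n)) ↔
      LinearIndepOn ℝ vp (S : Set (Fin n))) (J : Finset (Fin n)) (k : Fin n)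
    (h : v k ∈ Submodule.span ℝ (v '' (J : Set (Fin n)))) :
    vp k ∈ Submodule.span ℝ (vp '' (J : Set (Fin n))) := by
  classical
  obtain ⟨T, -, hTJ, hT, hTs⟩ := extend vp ∅ J (Finset.empty_subset _) (by simp)
  rw [hTs]
  by_contra hk
  have h1 := hT.insert hk
  rw [← Finset.coe_insert, ← hI] at h1
  have hkT : k ∉ T := fun hkT => hk (Submodule.subset_span ⟨k, hkT, rfl⟩)
  rw [Finset.coe_insert] at h1
  have h2 := h1.notMem_span_of_insert (by simpa using hkT)
  apply h2
  refine (Submodule.span_le.2 ?_) h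
  rintro _ ⟨y, hy, rfl⟩
  by_contra hyn
  have h3 := ((hI T).2 hT).insert hyn
  rw [← Finset.coe_insert, hI, Finset.coe_insert] at h3
  have hyT : y ∉ T := fun hyT => hyn (Submodule.subset_span ⟨y, hyT, rfl⟩)
  apply h3.notMem_span_of_insert (by simpa using hyT)
  rw [← hTs]
  exact Submodule.subset_span ⟨y, hy, rfl⟩

lemma F_le_of_bases {n d d' : ℕ} [NeZero n] (v : Fin n → Fin d → ℝ) (vp : Fin n → Fin d' → ℝ)
    (hI : ∀ S : Finset (Fin n), LinearIndepOn ℝ v (S : Set (Fin n)) ↔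
      LinearIndepOn ℝ vp (S : Set (Fin n))) (k : ℕ) : F vp k ≤ F v k := by
  classical
  rw [F_iff vp k _ (F_spec v k).1]
  have h := (F_spec v k).2
  have aux : ∀ (d : ℕ) (v : Fin n → Fin d → ℝ) (l : ℕ), SP v k l = Submodule.span ℝ
      (v '' (((Finset.Ioc k l).image (Fin.ofNat n) : Finset (Fin n)) : Set (Fin n))) := by
    intro d v l
    unfold SP
    rw [Finset.coe_image, ← Set.image_comp, Finset.coe_Ioc]
    rfl
  rw [aux] at h ⊢
  exact span_of_bases v vp hI _ _ h

end Positroid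

namespace Positroid

/-- positions mod `n` in a cyclic interval -/
def CI (n : ℕ) [NeZero n] (k l : ℕ) : Set (Fin n) := Fin.ofNat n '' Set.Ioc k l

lemma SP_eq {n d : ℕ} [NeZero n] (v : Fin n → Fin d → ℝ) (k l : ℕ) :
    SP v k l = Submodule.span ℝ (v '' CI n k l) := by
  unfold SP CI
  rw [Set.image_image]
  rfl

lemma mem_CI {n : ℕ} [NeZero n] (k l : ℕ) (hk : k < n) (hl : l < k + n) (m : Fin n) :
    m ∈ CI n k l ↔ (k < (m : ℕ) ∧ (m : ℕ) ≤ l) ∨ (m : ℕ) + n ≤ l := by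
  unfold CI
  have hm := m.2
  constructor
  · rintro ⟨t, ht, h⟩
    simp only [Set.mem_Ioc] at ht
    have h1 : t % n = m := by rw [← h]; simp
    by_cases htn : t < n
    · rw [Nat.mod_eq_of_lt htn] at h1; omega
    · rw [Nat.mod_eq_sub_mod (by omega), Nat.mod_eq_of_lt (by omega)] at h1; omega
  · rintro (h | h)
    · exact ⟨m, by simpa using h, by simp⟩
    · refine ⟨m + n, by simp only [Set.mem_Ioc]; omega, ?_⟩
      apply Fin.ext; simp [Nat.mod_eq_of_lt hm]

lemma F_iff_CI {n d : ℕ} [NeZero n] (v : Fin n → Fin d → ℝ) (k : Fin n) (l : ℕ) (h : (k : ℕ) ≤ l) :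
    F v k ≤ l ↔ v k ∈ Submodule.span ℝ (v '' CI n k l) := by
  rw [F_iff v k l h, W_fin, SP_eq]

lemma F_loop {n d : ℕ} [NeZero n] (v : Fin n → Fin d → ℝ) (k : Fin n) :
    F v k = k ↔ v k = 0 := by
  have h1 := (F_spec v k).1
  have h2 := F_iff v k k le_rfl
  rw [W_fin] at h2
  unfold SP at h2
  simp at h2
  rw [← h2]; omega

lemma F_coloop {n d : ℕ} [NeZero n] (v : Fin n → Fin d → ℝ) (k : Fin n) :
    F v k = k + n ↔ v k ∉ Submodule.span ℝ (v '' {k}ᶜ) := by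
  have hk := k.2
  have h1 := F_le v k
  have h2 := F_iff_CI v k (k + n - 1) (by omega)
  have h3 : CI n k (k + n - 1) = {k}ᶜ := by
    ext m
    rw [mem_CI _ _ hk (by omega)]
    have hm := m.2
    simp [Fin.ext_iff]
    omega
  rw [h3] at h2
  rw [← h2]; omega

lemma F_congr {n d : ℕ} [NeZero n] (v vp : Fin n → Fin d → ℝ) (k : Fin n)
    (h : ∀ l, (k : ℕ) ≤ l → l < k + n → (F v k ≤ l ↔ F vp k ≤ l)) : F v k = F vp k := by
  have a1 := (F_spec v k).1
  have a2 := F_le v k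
  have b1 := (F_spec vp k).1
  have b2 := F_le vp k
  rcases lt_trichotomy (F v k) (F vp k) with h1 | h1 | h1
  · have := (h _ a1 (by omega)).1 le_rfl; omega
  · exact h1
  · have := (h _ b1 (by omega)).2 le_rfl; omega

/-- drop loops and coloops from a spanning set -/
lemma drop_fixed {n d : ℕ} (v : Fin n → Fin d → ℝ) (x : Fin n) (S : Set (Fin n)) (hx : x ∉ S)
    (E : Finset (Fin n)) (hE : ∀ e ∈ E, e ≠ x ∧ (v e = 0 ∨ v e ∉ Submodule.span ℝ (v '' {e}ᶜ)))
    (h : v x ∈ Submodule.span ℝ (v '' (S ∪ E))) : v x ∈ Submodule.span ℝ (v '' S) := by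
  classical
  induction E using Finset.induction_on with
  | empty => simpa using h
  | insert e E he ih =>
    apply ih (fun a ha => hE a (Finset.mem_insert_of_mem ha))
    by_cases heS : e ∈ S
    · have : S ∪ (insert e E : Finset (Fin n)) = S ∪ (E : Set (Fin n)) := by
        ext a; simp; grind
      rwa [this] at h
    · have h1 : v '' (S ∪ (insert e E : Finset (Fin n))) = insert (v e) (v '' (S ∪ E)) := by
        rw [← Set.image_insert_eq]; congr 1; ext a; simp
      rw [h1] at h
      obtain ⟨hex, h0 | h0⟩ := hE e (Finset.mem_insert_self _ _)
      · rw [h0, Submodule.span_insert_zero] at h; exact h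
      · by_contra hc
        apply h0
        refine (Submodule.span_le.2 ?_) (mem_span_insert_exchange h hc)
        rintro _ (rfl | ⟨a, ha, rfl⟩)
        · exact Submodule.subset_span ⟨x, by simpa using hex.symm, rfl⟩
        · refine Submodule.subset_span ⟨a, ?_, rfl⟩
          rintro rfl
          rcases ha with ha | ha
          · exact heS ha
          · exact he ha

/-- add a multiple of column `i` to column `j` -/
noncomputable def upd {n d : ℕ} (v : Fin n → Fin d → ℝ) (i j : Fin n) (c : ℝ) :
    Fin n → Fin d → ℝ := Function.update v j (v j + c • v i)

section
variable {n d : ℕ} (v : Fin n → Fin d → ℝ) (i j : Fin n) (c : ℝ)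

lemma upd_ne {k : Fin n} (h : k ≠ j) : upd v i j c k = v k := by simp [upd, h]

lemma upd_j : upd v i j c j = v j + c • v i := by simp [upd]

lemma upd_image {S : Set (Fin n)} (h : j ∉ S) : upd v i j c '' S = v '' S := by
  apply Set.image_congr
  intro a ha
  apply upd_ne
  rintro rfl; exact h ha

lemma upd_span {S : Set (Fin n)} (hij : i ≠ j) (h : j ∈ S → i ∈ S) :
    Submodule.span ℝ (upd v i j c '' S) = Submodule.span ℝ (v '' S) := by
  by_cases hj : j ∈ S
  · have hi := h hj
    apply le_antisymm
    · rw [Submodule.span_le]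
      rintro _ ⟨a, ha, rfl⟩
      by_cases haj : a = j
      · subst haj
        rw [upd_j]
        exact Submodule.add_mem _ (Submodule.subset_span ⟨_, ha, rfl⟩)
          (Submodule.smul_mem _ _ (Submodule.subset_span ⟨_, hi, rfl⟩))
      · rw [upd_ne _ _ _ _ haj]
        exact Submodule.subset_span ⟨_, ha, rfl⟩
    · rw [Submodule.span_le]
      rintro _ ⟨a, ha, rfl⟩
      by_cases haj : a = j
      · subst haj
        have : v a = upd v i a c a - c • upd v i a c i := by
          rw [upd_j, upd_ne _ _ _ _ hij]; simp
        rw [this]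
        exact Submodule.sub_mem _ (Submodule.subset_span ⟨_, ha, rfl⟩)
          (Submodule.smul_mem _ _ (Submodule.subset_span ⟨_, hi, rfl⟩))
      · rw [← upd_ne v i j c haj]
        exact Submodule.subset_span ⟨_, ha, rfl⟩
  · rw [upd_image _ _ _ _ hj]

lemma upd_Sp (hij : i ≠ j) (h : Sp v) : Sp (upd v i j c) := by
  unfold Sp at *
  rw [← Set.image_univ] at *
  rw [upd_span _ _ _ _ hij (fun _ => Set.mem_univ _), h]

end

section
variable {n d : ℕ} [NeZero n] (v : Fin n → Fin d → ℝ) (i j : Fin n) (c : ℝ)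

lemma upd_F_other (hij : i < j)
    (hmid : ∀ k : Fin n, i < k → k < j → F v k = k ∨ F v k = k + n) (k : Fin n)
    (hki : k ≠ i) (hkj : k ≠ j) : F (upd v i j c) k = F v k := by
  by_cases hk : i < k ∧ k < j
  · rcases hmid k hk.1 hk.2 with h | h
    · rw [h, F_loop, upd_ne _ _ _ _ hkj, ← F_loop, h]
    · rw [h, F_coloop, upd_ne _ _ _ _ hkj, upd_span _ _ _ _ hij.ne, ← F_coloop, h]
      intro _; simpa using hki.symm
  · apply F_congr
    intro l hl hl2
    rw [F_iff_CI _ _ _ hl, F_iff_CI _ _ _ hl, upd_ne _ _ _ _ hkj, upd_span _ _ _ _ hij.ne]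
    rw [mem_CI _ _ k.2 hl2, mem_CI _ _ k.2 hl2]
    have : (i : ℕ) < j := hij
    have h3 : ¬ ((i : ℕ) < k ∧ (k : ℕ) < j) := hk
    have h4 : (k : ℕ) ≠ i := fun h => hki (Fin.ext h)
    have h5 : (k : ℕ) ≠ j := fun h => hkj (Fin.ext h)
    omega

lemma upd_F_i (hij : i < j) (hc : c ≠ 0)
    (hmid : ∀ k : Fin n, i < k → k < j → F v k = k ∨ F v k = k + n)
    (hlt : F v j < F v i) : F (upd v i j c) i = F v j := by
  have hij' : (i : ℕ) < j := hij
  have hj1 := (F_spec v j).1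
  have hi2 := F_le v i
  have hjn := j.2
  apply le_antisymm
  · rw [F_iff_CI _ _ _ (by omega), upd_ne _ _ _ _ hij.ne]
    have h1 := (F_iff_CI v j (F v j) hj1).1 le_rfl
    have hj0 : j ∉ CI n j (F v j) := by rw [mem_CI _ _ hjn (by omega)]; omega
    rw [← upd_image v i j c hj0] at h1
    have hsub : CI n j (F v j) ⊆ CI n i (F v j) := by
      intro a; rw [mem_CI _ _ hjn (by omega), mem_CI _ _ i.2 (by omega)]; omega
    have h2 := Submodule.span_mono (R := ℝ) (Set.image_mono (f := upd v i j c) hsub) h1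
    have h3 : upd v i j c j ∈ Submodule.span ℝ (upd v i j c '' CI n i (F v j)) := by
      refine Submodule.subset_span ⟨j, ?_, rfl⟩
      rw [mem_CI _ _ i.2 (by omega)]; omega
    have h4 := Submodule.sub_mem _ h3 h2
    rw [upd_j, add_sub_cancel_left] at h4
    have := Submodule.smul_mem _ c⁻¹ h4
    rwa [smul_smul, inv_mul_cancel₀ hc, one_smul] at this
  · by_contra hcon
    push Not at hcon
    set l := F (upd v i j c) i with hl
    have hil : (i : ℕ) ≤ l := (F_spec _ i).1
    have h1 := (F_iff_CI (upd v i j c) i l hil).1 le_rfl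
    rw [upd_ne _ _ _ _ hij.ne] at h1
    have hni : ¬ v i ∈ Submodule.span ℝ (v '' CI n i l) := by
      rw [← F_iff_CI v i l hil]; omega
    by_cases hlj : l < j
    · rw [upd_image _ _ _ _ (by rw [mem_CI _ _ i.2 (by omega)]; omega)] at h1
      exact hni h1
    · have hD : CI n i l = insert j (CI n j l ∪ (Finset.Ioo i j : Finset (Fin n))) := by
        ext a
        simp only [Set.mem_insert_iff, Set.mem_union, Finset.coe_Ioo, Set.mem_Ioo]
        rw [mem_CI _ _ i.2 (by omega), mem_CI _ _ j.2 (by omega), Fin.ext_iff, Fin.lt_def,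
          Fin.lt_def]
        omega
      set D : Set (Fin n) := CI n j l ∪ (Finset.Ioo i j : Finset (Fin n)) with hDdef
      have hjC : j ∉ CI n j l := by rw [mem_CI _ _ hjn (by omega)]; omega
      have hjD : j ∉ D := by
        simp [hDdef, hjC]
      rw [hD, Set.image_insert_eq, upd_j, upd_image _ _ _ _ hjD, Submodule.mem_span_insert] at h1
      obtain ⟨t, u, hu, h1⟩ := h1
      rw [hD, Set.image_insert_eq, Submodule.mem_span_insert] at hni
      by_cases htc : t * c = 1
      · have ht : t ≠ 0 := by rintro rfl; simp at htc
        have h5 : t • v j = - u := by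
          have : v i = t • v j + (t * c) • v i + u := by
            rw [mul_smul, ← smul_add]; exact h1
          rw [htc, one_smul] at this
          have h6 : t • v j + u = 0 := by
            have := congrArg (fun z => z - v i) this
            simp only [sub_self] at this
            rw [this]; abel
          exact eq_neg_of_add_eq_zero_left h6
        have h6 : v j ∈ Submodule.span ℝ (v '' D) := by
          have h7 : t • v j ∈ Submodule.span ℝ (v '' D) := by
            rw [h5]; exact Submodule.neg_mem _ hu
          have := Submodule.smul_mem _ t⁻¹ h7
          rwa [smul_smul, inv_mul_cancel₀ ht, one_smul] at this
        have h7 := drop_fixed v j (CI n j l) hjC (Finset.Ioo i j) ?_ h6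
        · rw [← F_iff_CI v j l (by omega)] at h7
          omega
        · intro e he
          rw [Finset.mem_Ioo] at he
          refine ⟨he.2.ne, ?_⟩
          rw [← F_coloop, ← F_loop]
          exact hmid e he.1 he.2
      · apply hni
        have h0 : 1 - t * c ≠ 0 := fun h => htc (by linarith)
        refine ⟨(1 - t * c)⁻¹ * t, (1 - t * c)⁻¹ • u, Submodule.smul_mem _ _ hu, ?_⟩
        rw [mul_smul, ← smul_add]
        rw [eq_inv_smul_iff₀ h0, sub_smul, one_smul]
        ext x
        have := congrFun h1 x
        simp only [Pi.add_apply, Pi.smul_apply, Pi.sub_apply, smul_eq_mul] at this ⊢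
        linarith

lemma upd_F_j (hij : i < j) (hc : c ≠ 0)
    (hmid : ∀ k : Fin n, i < k → k < j → F v k = k ∨ F v k = k + n)
    (hlt : F v j < F v i) : F (upd v i j c) j = F v i := by
  have hij' : (i : ℕ) < j := hij
  have hj1 := (F_spec v j).1
  have hi2 := F_le v i
  have hn := NeZero.pos n
  let f : Fin n → Fin n := fun k => ⟨F (upd v i j c) k % n, Nat.mod_lt _ hn⟩
  have hf : Function.Injective f := by
    intro a b hab
    have : F (upd v i j c) a % n = F (upd v i j c) b % n := by simpa [f] using hab
    exact Fin.ext (F_mod_inj _ a b a.2 b.2 this)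
  obtain ⟨k, hk⟩ := (Finite.injective_iff_surjective.1 hf) ⟨F v i % n, Nat.mod_lt _ hn⟩
  have hk : F (upd v i j c) k % n = F v i % n := by simpa [f] using hk
  have hkj : k = j := by
    by_contra hkj
    by_cases hki : k = i
    · subst hki
      rw [upd_F_i v k j c hij hc hmid hlt] at hk
      have := F_mod_inj v j k j.2 k.2 hk
      omega
    · rw [upd_F_other v i j c hij hmid k hki hkj] at hk
      exact hki (Fin.ext (F_mod_inj v k i k.2 i.2 hk))
  subst hkj
  have a1 := (F_spec (upd v i k c) k).1
  have a2 := F_le (upd v i k c) k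
  rcases le_total (F (upd v i k c) k) (F v i) with h | h
  · have := (Nat.modEq_iff_dvd' h).1 hk
    have := Nat.eq_zero_of_dvd_of_lt this (by omega)
    omega
  · have := (Nat.modEq_iff_dvd' h).1 hk.symm
    have := Nat.eq_zero_of_dvd_of_lt this (by omega)
    omega

end

lemma upd_NN {n d : ℕ} (v : Fin n → Fin d → ℝ) (i j : Fin n) (hij : i < j) (hN : NN v)
    (hmid : ∀ k : Fin n, i < k → k < j → v k = 0 ∨ v k ∉ Submodule.span ℝ (v '' {k}ᶜ)) :
    ∃ c : ℝ, c ≠ 0 ∧ NN (upd v i j c) := by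
  classical
  let P := (Finset.Ioo i j).filter (fun k => v k ∉ Submodule.span ℝ (v '' {k}ᶜ))
  have hP : ∀ k ∈ P, i < k ∧ k < j ∧ v k ∉ Submodule.span ℝ (v '' {k}ᶜ) := by
    intro k hk; simpa [P, and_assoc] using hk
  let w : Fin n → ℝ := fun k => ((k : ℕ) - (j : ℕ) : ℝ) * ((k : ℕ) - (i : ℕ) : ℝ)
  have hw : ∀ k, k ≠ i → k ≠ j → w k ≠ 0 := by
    intro k h1 h2
    have h1' : ((k : ℕ) : ℝ) ≠ ((i : ℕ) : ℝ) := by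
      intro h; exact h1 (Fin.ext (by exact_mod_cast h))
    have h2' : ((k : ℕ) : ℝ) ≠ ((j : ℕ) : ℝ) := by
      intro h; exact h2 (Fin.ext (by exact_mod_cast h))
    exact mul_ne_zero (sub_ne_zero.2 h2') (sub_ne_zero.2 h1')
  have hw' : ∀ k : Fin n, ¬ (i < k ∧ k < j) → 0 ≤ w k := by
    intro k hk
    have hij2 : ((i : ℕ) : ℝ) < ((j : ℕ) : ℝ) := by exact_mod_cast hij
    rcases le_or_gt k i with h | h
    · have : ((k : ℕ) : ℝ) ≤ ((i : ℕ) : ℝ) := by exact_mod_cast h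
      exact mul_nonneg_of_nonpos_of_nonpos (by linarith) (by linarith)
    · have h2 : j ≤ k := by by_contra h3; exact hk ⟨h, not_le.1 h3⟩
      have : ((j : ℕ) : ℝ) ≤ ((k : ℕ) : ℝ) := by exact_mod_cast h2
      exact mul_nonneg (by linarith) (by linarith)
  refine ⟨∏ k ∈ P, w k, ?_, ?_⟩
  · rw [Finset.prod_ne_zero_iff]
    intro k hk
    exact hw k (hP k hk).1.ne' (hP k hk).2.1.ne
  set c := ∏ k ∈ P, w k with hcdef
  intro g
  by_cases hg : Function.Injective g
  swap
  · have : V g = 0 := by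
      by_contra h0; exact hg ((V_ne_zero g).1 h0)
    simp [this]
  by_cases hj : j ∈ Set.range g
  swap
  · have : Dt (upd v i j c) g = Dt v g := by
      unfold Dt
      congr 2
      ext t : 1
      exact upd_ne _ _ _ _ (fun h => hj ⟨t, h⟩)
    rw [this]; exact hN g
  obtain ⟨t0, ht0⟩ := hj
  cases d with
  | zero => exact t0.elim0
  | succ e =>
  rw [← VDt_perm _ g (Equiv.swap 0 t0)]
  set h := g ∘ (Equiv.swap 0 t0) with hh
  have hinj : Function.Injective h := hg.comp (Equiv.injective _)
  have h00 : h 0 = j := by simp [hh, ht0]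
  set s : Fin e → Fin n := Fin.tail h with hs
  have hcons : h = Fin.cons j s := by rw [hs, ← h00, Fin.cons_self_tail]
  have hsj : ∀ t, s t ≠ j := by
    intro t ht
    have : h t.succ = h 0 := by rw [h00]; exact ht
    exact Fin.succ_ne_zero t (hinj this)
  have hsinj : Function.Injective s := by
    intro a b hab
    exact Fin.succ_injective _ (hinj hab)
  rw [hcons]
  have hD : Dt (upd v i j c) (Fin.cons j s) = Dt v (Fin.cons j s) + c * Dt v (Fin.cons i s) := by
    unfold Dt
    set M := Matrix.of (fun t => v ((Fin.cons j s : Fin (e + 1) → Fin n) t)) with hM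
    have e1 : Matrix.of (fun t => upd v i j c ((Fin.cons j s : Fin (e + 1) → Fin n) t)) =
        M.updateRow 0 (v j + c • v i) := by
      ext t x
      refine Fin.cases ?_ (fun t => ?_) t
      · simp [upd_j]
      · simp [Matrix.updateRow_ne (Fin.succ_ne_zero t), upd_ne _ _ _ _ (hsj t), hM]
    have e2 : Matrix.of (fun t => v ((Fin.cons i s : Fin (e + 1) → Fin n) t)) =
        M.updateRow 0 (v i) := by
      ext t x
      refine Fin.cases ?_ (fun t => ?_) t
      · simp
      · simp [Matrix.updateRow_ne (Fin.succ_ne_zero t), hM]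
    have e3 : M = M.updateRow 0 (v j) := by
      ext t x
      refine Fin.cases ?_ (fun t => ?_) t
      · simp [hM]
      · simp [Matrix.updateRow_ne (Fin.succ_ne_zero t)]
    rw [e1, e2, Matrix.det_updateRow_add, Matrix.det_updateRow_smul, ← e3]
  rw [hD, mul_add]
  apply add_nonneg (hN _)
  by_cases hDi : Dt v (Fin.cons i s) = 0
  · simp [hDi]
  have hinj2 := Dt_inj v _ hDi
  have hsp := (Dt_ne_zero_iff v _).1 hDi
  have hsi : ∀ t, s t ≠ i := by
    intro t ht
    have : (Fin.cons i s : Fin (e + 1) → Fin n) t.succ = (Fin.cons i s : Fin (e + 1) → Fin n) 0 := by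
      simpa using ht
    exact Fin.succ_ne_zero t (hinj2 this)
  -- coloops occur in s
  have hPs : P ⊆ Finset.univ.image s := by
    intro k hk
    by_contra hks
    apply (hP k hk).2.2
    have : (v k) ∈ (⊤ : Submodule ℝ (Fin (e + 1) → ℝ)) := trivial
    rw [← hsp] at this
    refine Submodule.span_mono (Set.image_mono ?_) this
    rintro _ ⟨t, rfl⟩
    refine Fin.cases ?_ (fun t => ?_) t
    · simpa using (hP k hk).1.ne
    · simp only [Fin.cons_succ, Set.mem_compl_iff, Set.mem_singleton_iff]
      rintro h; exact hks (by simp [← h])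
  have hprod : ∏ t, w (s t) = c * ∏ k ∈ (Finset.univ.image s) \ P, w k := by
    rw [mul_comm, hcdef, Finset.prod_sdiff hPs, Finset.prod_image (fun a _ b _ h => hsinj h)]
  have hrest : 0 ≤ ∏ k ∈ (Finset.univ.image s) \ P, w k := by
    apply Finset.prod_nonneg
    intro k hk
    rw [Finset.mem_sdiff] at hk
    apply hw'
    rintro ⟨h1, h2⟩
    obtain ⟨t, -, rfl⟩ := Finset.mem_image.1 hk.1
    rcases hmid _ h1 h2 with h3 | h3
    · apply hDi
      unfold Dt
      apply Matrix.det_eq_zero_of_row_eq_zero t.succ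
      intro x; simp [h3]
    · exact hk.2 (by simp [P, h1, h2]; exact h3)
  have hNi := hN (Fin.cons i s)
  have hVV : V (Fin.cons j s : Fin (e + 1) → Fin n) * V (Fin.cons i s : Fin (e + 1) → Fin n) =
      (∏ t, w (s t)) * V s ^ 2 := by
    rw [V_cons, V_cons]
    simp only [w, Finset.prod_mul_distrib]
    ring
  have hVi : V (Fin.cons i s : Fin (e + 1) → Fin n) ≠ 0 := (V_ne_zero _).2 hinj2
  have key : V (Fin.cons j s : Fin (e + 1) → Fin n) * (c * Dt v (Fin.cons i s)) *
      V (Fin.cons i s : Fin (e + 1) → Fin n) ^ 2 =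
      (c ^ 2 * (∏ k ∈ (Finset.univ.image s) \ P, w k) * V s ^ 2) *
        (V (Fin.cons i s : Fin (e + 1) → Fin n) * Dt v (Fin.cons i s)) := by
    calc _ = (V (Fin.cons j s : Fin (e + 1) → Fin n) * V (Fin.cons i s : Fin (e + 1) → Fin n)) *
        c * (V (Fin.cons i s : Fin (e + 1) → Fin n) * Dt v (Fin.cons i s)) := by ring
      _ = _ := by rw [hVV, hprod]; ring
  have h2 : 0 < V (Fin.cons i s : Fin (e + 1) → Fin n) ^ 2 := by positivity
  refine nonneg_of_mul_nonneg_left ?_ h2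
  rw [key]
  positivity

/-- one realization step -/
theorem step {n d : ℕ} [NeZero n] (v : Fin n → Fin d → ℝ) (hS : Sp v) (hN : NN v) (i j : Fin n)
    (hij : i < j) (hmid : ∀ k : Fin n, i < k → k < j → F v k = k ∨ F v k = k + n)
    (hlt : F v j < F v i) :
    ∃ vp : Fin n → Fin d → ℝ, Sp vp ∧ NN vp ∧ ∀ k : Fin n, F vp k = F v (Equiv.swap i j k) := by
  obtain ⟨c, hc, hNc⟩ := upd_NN v i j hij hN (fun k h1 h2 => by
    rw [← F_coloop, ← F_loop]; exact hmid k h1 h2)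
  refine ⟨upd v i j c, upd_Sp v i j c hij.ne hS, hNc, fun k => ?_⟩
  by_cases hki : k = i
  · subst hki; rw [Equiv.swap_apply_left]; exact upd_F_i v k j c hij hc hmid hlt
  by_cases hkj : k = j
  · subst hkj; rw [Equiv.swap_apply_right]; exact upd_F_j v i k c hij hc hmid hlt
  rw [Equiv.swap_apply_of_ne_of_ne hki hkj]
  exact upd_F_other v i j c hij hmid k hki hkj

end Positroid

namespace Positroid

/-- bounded affine permutations, as functions on one period -/
def IsBAP {n : ℕ} (σ : Fin n → ℕ) : Prop :=
  (∀ k : Fin n, (k : ℕ) ≤ σ k ∧ σ k ≤ k + n) ∧ Function.Injective (fun k => σ k % n)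

lemma F_isBAP {n d : ℕ} [NeZero n] (v : Fin n → Fin d → ℝ) : IsBAP (fun k : Fin n => F v k) :=
  ⟨fun k => ⟨(F_spec v k).1, F_le v k⟩, fun a b h => Fin.ext (F_mod_inj v a b a.2 b.2 h)⟩

lemma realize_base {n : ℕ} [NeZero n] (σ : Fin n → ℕ) (h : ∀ k, σ k = k ∨ σ k = k + n) :
    ∃ (d : ℕ) (v : Fin n → Fin d → ℝ), Sp v ∧ NN v ∧ ∀ k : Fin n, F v k = σ k := by
  classical
  have hn := NeZero.pos n
  set K : Finset (Fin n) := Finset.univ.filter (fun k => σ k = k + n) with hK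
  set e := K.orderEmbOfFin rfl with he
  have heK : ∀ x, e x ∈ K := fun x => Finset.orderEmbOfFin_mem K rfl x
  set v : Fin n → Fin K.card → ℝ := fun k x => if e x = k then 1 else 0 with hv
  have hve : ∀ x, v (e x) = Pi.single x 1 := by
    intro x
    ext y
    by_cases hxy : y = x
    · subst hxy; simp [hv]
    · have : e y ≠ e x := fun h => hxy (e.injective h)
      simp [hv, hxy]
  have hv0 : ∀ k, k ∉ K → v k = 0 := by
    intro k hk
    ext y
    have : e y ≠ k := fun h => hk (h ▸ heK y)
    simp [hv, this]
  have hsurj : ∀ k ∈ K, ∃ x, e x = k := by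
    intro k hk
    have : k ∈ Set.range e := by rw [he, Finset.range_orderEmbOfFin]; exact hk
    exact this
  refine ⟨K.card, v, ?_, ?_, ?_⟩
  · unfold Sp
    rw [eq_top_iff, ← (Pi.basisFun ℝ (Fin K.card)).span_eq]
    apply Submodule.span_mono
    rintro _ ⟨x, rfl⟩
    exact ⟨e x, by rw [hve]; simp⟩
  · intro g
    by_cases hg : Function.Injective g
    swap
    · have : V g = 0 := by
        by_contra h0; exact hg ((V_ne_zero g).1 h0)
      simp [this]
    by_cases hgK : ∀ t, g t ∈ K
    swap
    · push Not at hgK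
      obtain ⟨t, ht⟩ := hgK
      have : Dt v g = 0 := by
        unfold Dt
        apply Matrix.det_eq_zero_of_row_eq_zero t
        intro x; simp [hv0 _ ht]
      simp [this]
    rw [← VDt_perm _ g (Tuple.sort g)]
    have hm : StrictMono (g ∘ Tuple.sort g) :=
      (Tuple.monotone_sort g).strictMono_of_injective (hg.comp (Equiv.injective _))
    have : g ∘ Tuple.sort g = e :=
      Finset.orderEmbOfFin_unique rfl (fun x => hgK _) hm
    rw [this] at hm ⊢
    have h1 : Dt v e = 1 := by
      unfold Dt
      have : Matrix.of (fun i => v (e i)) = 1 := by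
        ext a b
        simp only [Matrix.of_apply, hve, Matrix.one_apply, Pi.single_apply, eq_comm]
      rw [this, Matrix.det_one]
    rw [h1, mul_one]
    exact (V_pos _ hm).le
  · intro k
    rcases h k with hk | hk
    · rw [hk, F_loop]
      apply hv0
      simp [hK, hk]; omega
    · rw [hk, F_coloop]
      obtain ⟨x, rfl⟩ := hsurj k (by simp [hK, hk])
      intro hmem
      have hle : Submodule.span ℝ (v '' {e x}ᶜ) ≤ LinearMap.ker (LinearMap.proj (R := ℝ)
          (φ := fun _ : Fin K.card => ℝ) x) := by
        rw [Submodule.span_le]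
        rintro _ ⟨a, ha, rfl⟩
        have : e x ≠ a := fun h => ha (by simp [h])
        simp [hv, this]
      have := hle hmem
      rw [hve] at this
      simp at this

lemma nonfixed_res {n : ℕ} [NeZero n] (σ : Fin n → ℕ) (hσ : IsBAP σ) (k r : Fin n)
    (hk : σ k ≠ k ∧ σ k ≠ k + n) (hr : σ k % n = r) : σ r ≠ r ∧ σ r ≠ r + n := by
  have hr2 := r.2
  have key : σ r % n = r → False := by
    intro h
    have : r = k := hσ.2 (by simp only; rw [h, hr])
    subst this
    have h1 := hσ.1 r
    by_cases h2 : σ r < n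
    · rw [Nat.mod_eq_of_lt h2] at hr; exact hk.1 hr
    · rw [Nat.mod_eq_sub_mod (by omega)] at hr
      by_cases h3 : σ r - n < n
      · rw [Nat.mod_eq_of_lt h3] at hr; omega
      · omega
  constructor
  · intro h; apply key; rw [h]; exact Nat.mod_eq_of_lt hr2
  · intro h; apply key; rw [h]; simp [Nat.mod_eq_of_lt hr2]

lemma adj_pair {n : ℕ} (σ : Fin n → ℕ) (hσ : Function.Injective σ) (N : Finset (Fin n)) :
    ∀ (t : ℕ) (i j : Fin n), (j : ℕ) - i ≤ t → i ∈ N → j ∈ N → i < j → σ i < σ j →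
    ∃ i j : Fin n, i ∈ N ∧ j ∈ N ∧ i < j ∧ σ i < σ j ∧ ∀ k, i < k → k < j → k ∉ N := by
  intro t
  induction t with
  | zero =>
    intro i j h1 _ _ hij
    have : (i : ℕ) < j := hij
    omega
  | succ t ih =>
    intro i j h1 hi hj hij hlt
    by_cases hk : ∃ k, i < k ∧ k < j ∧ k ∈ N
    · obtain ⟨k, hik, hkj, hkN⟩ := hk
      have a1 : (i : ℕ) < k := hik
      have a2 : (k : ℕ) < j := hkj
      by_cases h2 : σ i < σ k
      · exact ih i k (by omega) hi hkN hik h2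
      · have h3 : σ k ≠ σ i := fun h => hik.ne' (hσ h)
        exact ih k j (by omega) hkN hj hkj (by omega)
    · push Not at hk
      exact ⟨i, j, hi, hj, hij, hlt, hk⟩

theorem realize {n : ℕ} [NeZero n] : ∀ (t : ℕ) (σ : Fin n → ℕ), ∑ k : Fin n, (k : ℕ) * σ k ≤ t →
    IsBAP σ → ∃ (d : ℕ) (v : Fin n → Fin d → ℝ), Sp v ∧ NN v ∧ ∀ k : Fin n, F v k = σ k := by
  classical
  intro t
  induction t using Nat.strong_induction_on with
  | _ t ih =>
  intro σ ht hσ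
  by_cases hbase : ∀ k, σ k = k ∨ σ k = k + n
  · exact realize_base σ hbase
  push Not at hbase
  have hn := NeZero.pos n
  have hinj : Function.Injective σ := fun a b h => hσ.2 (by simp only [h])
  set N : Finset (Fin n) := Finset.univ.filter (fun k => σ k ≠ k ∧ σ k ≠ k + n) with hN
  have hmemN : ∀ k, k ∈ N ↔ σ k ≠ k ∧ σ k ≠ k + n := by intro k; simp [hN]
  have hne : N.Nonempty := by
    obtain ⟨k, hk⟩ := hbase; exact ⟨k, (hmemN k).2 hk⟩
  have hres : ∀ k ∈ N, ∀ r : Fin n, σ k % n = r → r ∈ N := fun k hk r hr =>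
    (hmemN r).2 (nonfixed_res σ hσ k r ((hmemN k).1 hk) hr)
  -- an initial pair
  have hpair : ∃ i j : Fin n, i ∈ N ∧ j ∈ N ∧ i < j ∧ σ i < σ j := by
    set m := N.min' hne
    set M := N.max' hne
    have hm : m ∈ N := N.min'_mem hne
    have hM : M ∈ N := N.max'_mem hne
    have hm1 := (hmemN m).1 hm
    have hM1 := (hmemN M).1 hM
    have hm2 := hσ.1 m
    have hM2 := hσ.1 M
    have hr := hres M hM ⟨σ M % n, Nat.mod_lt _ hn⟩ rfl
    have hr1 : m ≤ _ := N.min'_le _ hr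
    have hr2 : _ ≤ M := N.le_max' _ hr
    have hr1' : (m : ℕ) ≤ σ M % n := hr1
    have hr2' : σ M % n ≤ (M : ℕ) := hr2
    have h1 : ¬ σ M < n := by
      intro h; rw [Nat.mod_eq_of_lt h] at hr2'; omega
    rw [Nat.mod_eq_sub_mod (by omega)] at hr1'
    have h2 := Nat.mod_le (σ M - n) n
    have h3 : σ m < σ M := by omega
    have h4 : m ≤ M := N.min'_le _ hM
    refine ⟨m, M, hm, hM, lt_of_le_of_ne h4 ?_, h3⟩
    intro h; rw [h] at h3; omega
  obtain ⟨i0, j0, hi0, hj0, hij0, hlt0⟩ := hpair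
  obtain ⟨i, j, hi, hj, hij, hlt, hbet⟩ := adj_pair σ hinj N _ i0 j0 le_rfl hi0 hj0 hij0 hlt0
  have hij' : (i : ℕ) < j := hij
  have hi1 := (hmemN i).1 hi
  have hj1 := (hmemN j).1 hj
  have hi2 := hσ.1 i
  have hj2 := hσ.1 j
  have hjn := j.2
  have hb1 : σ j ≤ i + n := by
    by_contra hcon
    have hr : σ j % n = (⟨σ j - n, by omega⟩ : Fin n) := by
      rw [Nat.mod_eq_sub_mod (by omega)]; exact Nat.mod_eq_of_lt (by omega)
    exact hbet _ (by rw [Fin.lt_def]; simp only; omega) (by rw [Fin.lt_def]; simp only; omega)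
      (hres j hj _ hr)
  have hb2 : (j : ℕ) ≤ σ i := by
    by_contra hcon
    have hr : σ i % n = (⟨σ i, by omega⟩ : Fin n) := by
      exact Nat.mod_eq_of_lt (by omega)
    exact hbet _ (by rw [Fin.lt_def]; simp only; omega) (by rw [Fin.lt_def]; simp only; omega)
      (hres i hi _ hr)
  set τ : Fin n → ℕ := fun k => σ (Equiv.swap i j k) with hτ
  have hτi : τ i = σ j := by simp [hτ]
  have hτj : τ j = σ i := by simp [hτ]
  have hτo : ∀ k, k ≠ i → k ≠ j → τ k = σ k := by
    intro k h1 h2; simp [hτ, Equiv.swap_apply_of_ne_of_ne h1 h2]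
  have hτB : IsBAP τ := by
    refine ⟨fun k => ?_, ?_⟩
    · by_cases h1 : k = i
      · subst h1; rw [hτi]; omega
      by_cases h2 : k = j
      · subst h2; rw [hτj]; omega
      rw [hτo k h1 h2]; exact hσ.1 k
    · exact hσ.2.comp (Equiv.swap i j).injective
  have hsum : ∑ k : Fin n, (k : ℕ) * τ k < ∑ k : Fin n, (k : ℕ) * σ k := by
    have h1 : ∑ k : Fin n, (((k : ℕ) : ℤ) * σ k - ((k : ℕ) : ℤ) * τ k) =
        (((i : ℕ) : ℤ) * σ i - ((i : ℕ) : ℤ) * τ i) + (((j : ℕ) : ℤ) * σ j - ((j : ℕ) : ℤ) * τ j) := by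
      apply Fintype.sum_eq_add i j hij.ne
      rintro k ⟨hk1, hk2⟩
      rw [hτo k hk1 hk2]; ring
    rw [hτi, hτj, Finset.sum_sub_distrib] at h1
    have h2 : (0 : ℤ) < (((j : ℕ) : ℤ) - ((i : ℕ) : ℤ)) * ((σ j : ℤ) - σ i) := by
      apply mul_pos <;> omega
    have h3 : (∑ k : Fin n, ((k : ℕ) : ℤ) * (τ k : ℤ)) < ∑ k : Fin n, ((k : ℕ) : ℤ) * (σ k : ℤ) := by
      nlinarith
    exact_mod_cast h3
  obtain ⟨d, v, hS, hNN, hF⟩ := ih _ (lt_of_lt_of_le hsum ht) τ le_rfl hτB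
  obtain ⟨vp, hS', hN', hF'⟩ := step v hS hNN i j hij (by
    intro k h1 h2
    rw [hF, hτo k h1.ne' h2.ne]
    have := hbet k h1 h2
    rw [hmemN] at this
    tauto) (by rw [hF, hF, hτi, hτj]; exact hlt)
  refine ⟨d, vp, hS', hN', fun k => ?_⟩
  rw [hF', hF]
  simp [hτ]

end Positroid

namespace Positroid

lemma same_bases {n d d' : ℕ} [NeZero n] (A : Matrix (Fin d) (Fin n) ℝ) (A' : Matrix (Fin d') (Fin n) ℝ)
    (hA : A.TotallyNonneg) (hA' : A'.TotallyNonneg)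
    (h : ∀ k : Fin n, F A.col k = F A'.col k) (B : Finset (Fin n)) :
    (B.card = d ∧ LinearIndepOn ℝ A.col (B : Set (Fin n))) →
    (B.card = d' ∧ LinearIndepOn ℝ A'.col (B : Set (Fin n))) := by
  rw [tnn_iff] at hA hA'
  have h' : ∀ k, k < n → F A.col k = F A'.col k := fun k hk => h ⟨k, hk⟩
  have hd : d = d' := by
    rw [← R_all A.col hA.1, ← R_all A'.col hA'.1]
    exact R_eq _ _ h' _ _
  subst hd
  rintro ⟨h1, h2⟩
  exact ⟨h1, indep_of_F A'.col A.col hA'.1 hA'.2 (fun k hk => (h' k hk).symm) B h1 h2⟩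

lemma same_F {n d d' : ℕ} [NeZero n] (v : Fin n → Fin d → ℝ) (vp : Fin n → Fin d' → ℝ)
    (hS : Sp v) (hS' : Sp vp)
    (h : ∀ B : Finset (Fin n), (B.card = d ∧ LinearIndepOn ℝ v (B : Set (Fin n))) ↔
    (B.card = d' ∧ LinearIndepOn ℝ vp (B : Set (Fin n)))) (k : ℕ) : F v k = F vp k := by
  have hI : ∀ S : Finset (Fin n), LinearIndepOn ℝ v (S : Set (Fin n)) ↔
      LinearIndepOn ℝ vp (S : Set (Fin n)) := by
    intro S
    rw [indep_iff_basis v hS, indep_iff_basis vp hS']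
    simp only [h]
  exact le_antisymm (F_le_of_bases vp v (fun S => (hI S).symm) k) (F_le_of_bases v vp hI k)

theorem card_positroids {n : ℕ} [NeZero n] :
    numPositroids n = Nat.card {σ : Fin n → ℕ // IsBAP σ} := by
  classical
  unfold numPositroids
  have hch : ∀ ℬ : {ℬ : Finset (Finset (Fin n)) // IsPositroid (fun B => B ∈ ℬ)},
      ∃ (d : ℕ) (A : Matrix (Fin d) (Fin n) ℝ), A.TotallyNonneg ∧
        A.RepresentsBases (fun B => B ∈ ℬ.1) := fun ℬ => ℬ.2
  choose d A hA hR using hch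
  let Φ : {ℬ : Finset (Finset (Fin n)) // IsPositroid (fun B => B ∈ ℬ)} →
      {σ : Fin n → ℕ // IsBAP σ} := fun ℬ => ⟨fun k => F (A ℬ).col k, F_isBAP _⟩
  apply Nat.card_congr
  refine Equiv.ofBijective Φ ⟨?_, ?_⟩
  · intro ℬ ℬ' h
    have h1 : ∀ k : Fin n, F (A ℬ).col k = F (A ℬ').col k := by
      intro k
      have := congrArg Subtype.val h
      exact congrFun this k
    apply Subtype.ext
    ext B
    exact ((hR ℬ B).trans ⟨same_bases _ _ (hA ℬ) (hA ℬ') h1 B,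
      same_bases _ _ (hA ℬ') (hA ℬ) (fun k => (h1 k).symm) B⟩).trans (hR ℬ' B).symm
  · rintro ⟨σ, hσ⟩
    obtain ⟨e, v, hS, hN, hF⟩ := realize _ σ le_rfl hσ
    let A' : Matrix (Fin e) (Fin n) ℝ := Matrix.of fun x k => v k x
    have hcol : A'.col = v := rfl
    let ℬ : Finset (Finset (Fin n)) := Finset.univ.filter
      (fun B => B.card = e ∧ LinearIndepOn ℝ v (B : Set (Fin n)))
    have hℬ : ∀ B, B ∈ ℬ ↔ B.card = e ∧ LinearIndepOn ℝ v (B : Set (Fin n)) := by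
      intro B; simp [ℬ]
    have hpos : IsPositroid (fun B => B ∈ ℬ) := ⟨e, A', (tnn_iff A').2 ⟨hS, hN⟩, hℬ⟩
    refine ⟨⟨ℬ, hpos⟩, ?_⟩
    apply Subtype.ext
    ext k
    change F (A ⟨ℬ, hpos⟩).col k = σ k
    rw [← hF]
    refine same_F _ v ((tnn_iff _).1 (hA ⟨ℬ, hpos⟩)).1 hS ?_ k
    intro B
    exact (hR ⟨ℬ, hpos⟩ B).symm.trans (hℬ B)

/-- bounded affine permutation of a decorated permutation -/
def mk {n : ℕ} (L : Finset (Fin n)) (π : Equiv.Perm (Fin n)) (k : Fin n) : ℕ :=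
  if k ∈ L then k else if k < π k then π k else π k + n

lemma mk_mod {n : ℕ} (L : Finset (Fin n)) (π : Equiv.Perm (Fin n)) (h : ∀ a ∈ L, π a = a)
    (k : Fin n) : mk L π k % n = π k := by
  have := (π k).2
  have hk := k.2
  unfold mk
  split_ifs with h1 h2
  · rw [h k h1, Nat.mod_eq_of_lt hk]
  · rw [Nat.mod_eq_of_lt this]
  · rw [Nat.add_mod_right, Nat.mod_eq_of_lt this]

lemma mk_isBAP {n : ℕ} (L : Finset (Fin n)) (π : Equiv.Perm (Fin n)) (h : ∀ a ∈ L, π a = a) :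
    IsBAP (mk L π) := by
  constructor
  · intro k
    have h2 := (π k).2
    have hk := k.2
    unfold mk
    simp only [Fin.lt_def]
    split_ifs <;> omega
  · intro a b hab
    simp only [mk_mod L π h] at hab
    exact π.injective (Fin.ext hab)

lemma mk_eq {n : ℕ} (L : Finset (Fin n)) (π : Equiv.Perm (Fin n)) (k : Fin n) :
    mk L π k = k ↔ k ∈ L := by
  have h2 := (π k).2
  have hk := k.2
  unfold mk
  simp only [Fin.lt_def]
  split_ifs with h1 h3
  · simp [h1]
  · simp only [h1, iff_false]; omega
  · simp only [h1, iff_false]; omega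

theorem card_BAP (n : ℕ) (hn : 0 < n) : Nat.card {σ : Fin n → ℕ // IsBAP σ} =
    ∑ k ∈ Finset.range (n + 1), n.factorial / k.factorial := by
  classical
  let T := Σ L : Finset (Fin n), {π : Equiv.Perm (Fin n) // ∀ a, ¬ (a ∉ L) → π a = a}
  let Θ : T → {σ : Fin n → ℕ // IsBAP σ} := fun x =>
    ⟨mk x.1 x.2.1, mk_isBAP _ _ (fun a ha => x.2.2 a (not_not.2 ha))⟩
  have hΘ : Function.Bijective Θ := by
    constructor
    · rintro ⟨L, π, hπ⟩ ⟨L', π', hπ'⟩ h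
      have h1 : mk L π = mk L' π' := congrArg Subtype.val h
      have hL : L = L' := by
        ext k; rw [← mk_eq L π, ← mk_eq L' π', h1]
      subst hL
      have hp : π = π' := by
        ext k
        rw [← mk_mod L π (fun a ha => hπ a (not_not.2 ha)), h1,
          mk_mod L π' (fun a ha => hπ' a (not_not.2 ha))]
      subst hp
      rfl
    · rintro ⟨σ, hσ⟩
      let f : Fin n → Fin n := fun k => ⟨σ k % n, Nat.mod_lt _ hn⟩
      have hf : Function.Injective f := by
        intro a b hab
        apply hσ.2
        simpa [f] using hab
      let π : Equiv.Perm (Fin n) := Equiv.ofBijective f (Finite.injective_iff_bijective.1 hf)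
      have hπ : ∀ k, (π k : ℕ) = σ k % n := fun k => rfl
      refine ⟨⟨Finset.univ.filter (fun k => σ k = k), π, ?_⟩, ?_⟩
      · intro a ha
        have ha : σ a = a := by simpa using ha
        apply Fin.ext
        rw [hπ, ha, Nat.mod_eq_of_lt a.2]
      · apply Subtype.ext
        ext k
        change mk _ π k = σ k
        have h1 := hσ.1 k
        have hk := k.2
        unfold mk
        simp only [Fin.lt_def, hπ, Finset.mem_filter, Finset.mem_univ, true_and]
        split_ifs with h2 h3
        · exact h2.symm
        · by_cases h4 : σ k < n
          · exact Nat.mod_eq_of_lt h4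
          · rw [Nat.mod_eq_sub_mod (by omega)] at h3 ⊢
            have := Nat.mod_le (σ k - n) n
            omega
        · by_cases h4 : σ k < n
          · rw [Nat.mod_eq_of_lt h4] at h3; omega
          · rw [Nat.mod_eq_sub_mod (by omega)] at h3 ⊢
            by_cases h5 : σ k - n < n
            · rw [Nat.mod_eq_of_lt h5] at h3 ⊢; omega
            · omega
  rw [← Nat.card_congr (Equiv.ofBijective Θ hΘ)]
  have hfib : ∀ L : Finset (Fin n), Nat.card {π : Equiv.Perm (Fin n) // ∀ a, ¬ (a ∉ L) → π a = a}
      = (n - L.card).factorial := by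
    intro L
    rw [← Nat.card_congr (Equiv.Perm.subtypeEquivSubtypePerm (fun a => a ∉ L)),
      Nat.card_eq_fintype_card, Fintype.card_perm]
    congr 1
    rw [Fintype.card_subtype_compl]
    simp
  have h2 : Nat.card T = ∑ L : Finset (Fin n), (n - L.card).factorial := by
    simp only [T]
    rw [Nat.card_sigma]
    exact Finset.sum_congr rfl fun L _ => hfib L
  rw [h2, ← Finset.powerset_univ, Finset.sum_powerset_apply_card (fun m => (n - m).factorial)]
  simp only [Finset.card_univ, Fintype.card_fin, smul_eq_mul]
  refine Finset.sum_congr rfl fun k hk => ?_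
  have hk : k ≤ n := by simpa [Nat.lt_succ_iff] using hk
  have h3 := Nat.choose_mul_factorial_mul_factorial hk
  symm
  apply Nat.div_eq_of_eq_mul_left (Nat.factorial_pos k)
  rw [← h3]; ring

theorem formula (n : ℕ) (hn : 1 ≤ n) :
    numPositroids n = ∑ k ∈ Finset.range (n + 1), n.factorial / k.factorial := by
  haveI : NeZero n := ⟨by omega⟩
  rw [card_positroids, card_BAP n hn]

theorem limit : Filter.Tendsto (fun n : ℕ => (numPositroids n : ℝ) / (n.factorial : ℝ))
      Filter.atTop (nhds (Real.exp 1)) := by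
  have h := (NormedSpace.expSeries_div_hasSum_exp (1 : ℝ)).tendsto_sum_nat
  rw [← Real.exp_eq_exp_ℝ] at h
  have h2 := (Filter.tendsto_add_atTop_iff_nat 1).2 h
  refine h2.congr' ?_
  filter_upwards [Filter.eventually_ge_atTop 1] with n hn
  rw [formula n hn, Nat.cast_sum, Finset.sum_div]
  refine Finset.sum_congr rfl fun k hk => ?_
  have hk : k ≤ n := by simpa [Nat.lt_succ_iff] using hk
  rw [Nat.cast_div (Nat.factorial_dvd_factorial hk) (by positivity)]
  have : (n.factorial : ℝ) ≠ 0 := by positivity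
  have : (k.factorial : ℝ) ≠ 0 := by positivity
  simp
  field_simp

end Positroid

/-- The number `p(n)` of positroids on `[n]` equals
`Σ_{k=0}^{n} n!/k!` for every `n ≥ 1` (the division being exact), and
consequently `p(n)/n! → e` as `n → ∞`. -/
theorem numPositroids_formula_and_limit :
    (∀ n : ℕ, 1 ≤ n →
      numPositroids n = ∑ k ∈ Finset.range (n + 1), n.factorial / k.factorial) ∧
    Filter.Tendsto (fun n : ℕ => (numPositroids n : ℝ) / (n.factorial : ℝ))
      Filter.atTop (nhds (Real.exp 1)) := by
  exact ⟨Positroid.formula, Positroid.limit⟩
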